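/- arXiv:1010.4220 — 2 statements merged into one kernel-verified Lean document; each statement's English description precedes it below -/
import Mathlib

section
/- If w ∈ F is unimodular and k ≥ 2, then ⟨G, G^t⟩ = G ∗ G^t in G̃; precisely, the group homomorphism from the free product G ∗ G to G̃ that sends the first free factor by g ↦ ι̃(g) and the second free factor by g ↦ t̄⁻¹ · ι̃(g) · t̄ is injective. In particular G̃ contains the free square of G. -/
/-- `F = G ∗ ⟨t⟩`: the free product of `G` with an infinite cyclic group. -/
abbrev FP (G : Type*) [Group G] : Type _ := Monoid.Coprod G (FreeGroup Unit)

/-- The additional generator `t ∈ F`. -/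
def tgen (G : Type*) [Group G] : FP G := Monoid.Coprod.inr (FreeGroup.of ())

/-- The canonical embedding `ι : G → F`. -/
def emb (G : Type*) [Group G] : G →* FP G := Monoid.Coprod.inl

/-- The exponent-sum homomorphism `σ : F → ℤ` killing `G` and sending `t` to `1`. -/
def expSum (G : Type*) [Group G] : FP G →* Multiplicative ℤ :=
  Monoid.Coprod.lift 1 (FreeGroup.lift fun _ => Multiplicative.ofAdd (1 : ℤ))

/-- A word `w ∈ F` is unimodular if the exponent sum of `t` in `w` is `1`. -/
def Unimodular {G : Type*} [Group G] (w : FP G) : Prop :=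
  expSum G w = Multiplicative.ofAdd (1 : ℤ)

open Monoid Function

section FreeProducts

theorem neWord_prod_ne_one {ι : Type*} {H : ι → Type*} [∀ i, Group (H i)] {i j : ι}
    (w : CoprodI.NeWord H i j) : w.prod ≠ 1 := by
  classical
  intro h
  have h' : w.toWord = CoprodI.Word.empty :=
    CoprodI.Word.equiv.symm.injective (h.trans CoprodI.Word.prod_empty.symm)
  exact w.toList_ne_nil (congrArg CoprodI.Word.toList h')

theorem exists_neWord_prod_eq {ι : Type*} {H : ι → Type*} [∀ i, Group (H i)]
    {x : CoprodI H} (hx : x ≠ 1) :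
    ∃ i j, ∃ w : CoprodI.NeWord H i j, w.prod = x := by
  classical
  obtain ⟨i, j, w, hw⟩ := CoprodI.NeWord.of_word (CoprodI.Word.equiv x) fun h => hx <|
    CoprodI.Word.equiv.injective (h.trans (by simp [CoprodI.Word.equiv]))
  exact ⟨i, j, w, (congrArg CoprodI.Word.prod hw).trans (CoprodI.Word.equiv.symm_apply_apply x)⟩

/-- If nontrivial elements of each `A k` are sent to reduced words which begin and end with letters
indexed by `S k`, for pairwise disjoint sets `S k`, then the `A k` generate their free product. -/
theorem coprodI_lift_injective_of_neWord {κ ι : Type*} {A : κ → Type*} {H : ι → Type*}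
    [∀ k, Group (A k)] [∀ i, Group (H i)] (f : ∀ k, A k →* CoprodI H) (S : κ → Set ι)
    (hS : Pairwise fun k l => Disjoint (S k) (S l))
    (hf : ∀ k (a : A k), a ≠ 1 →
      ∃ i ∈ S k, ∃ j ∈ S k, ∃ w : CoprodI.NeWord H i j, w.prod = f k a) :
    Injective (CoprodI.lift f) := by
  classical
  have key : ∀ {k l} (w : CoprodI.NeWord A k l), ∃ i ∈ S k, ∃ j ∈ S l,
      ∃ w' : CoprodI.NeWord H i j, w'.prod = CoprodI.lift f w.prod := by
    intro k l w
    induction w with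
    | singleton x hx => simpa using hf _ x hx
    | append w₁ hne w₂ ih₁ ih₂ =>
      obtain ⟨i, hi, j, hj, w₁', h₁⟩ := ih₁
      obtain ⟨i', hi', j', hj', w₂', h₂⟩ := ih₂
      have hne' : j ≠ i' := by
        rintro rfl
        exact Set.disjoint_left.1 (hS hne) hj hi'
      exact ⟨i, hi, j', hj', .append w₁' hne' w₂', by simp [h₁, h₂]⟩
  rw [injective_iff_map_eq_one]
  intro a ha
  by_contra hne
  obtain ⟨k, l, w, rfl⟩ := exists_neWord_prod_eq hne
  obtain ⟨i, -, j, -, w', hw'⟩ := key w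
  exact neWord_prod_ne_one w' (hw'.trans ha)

/-- The free product of copies of `G` indexed by `ι`. -/
abbrev FreePower (ι G : Type*) [Group G] : Type _ := CoprodI fun _ : ι => G

namespace FreePower

variable {ι κ ν G : Type*} [Group G]

/-- The homomorphism of free powers induced by a map of the index sets. -/
def reindex (f : ι → κ) : FreePower ι G →* FreePower κ G :=
  CoprodI.lift fun i => CoprodI.of (M := fun _ : κ => G) (i := f i)

@[simp]
theorem reindex_of (f : ι → κ) (i : ι) (g : G) :
    reindex f (CoprodI.of (M := fun _ : ι => G) (i := i) g) =
      CoprodI.of (M := fun _ : κ => G) (i := f i) g := by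
  simp [reindex]

theorem reindex_comp (f : ι → κ) (h : κ → ν) :
    (reindex h).comp (reindex f) = reindex (G := G) (h ∘ f) := by
  ext i g
  simp

theorem reindex_reindex (f : ι → κ) (h : κ → ν) (x : FreePower ι G) :
    reindex h (reindex f x) = reindex (h ∘ f) x :=
  DFunLike.congr_fun (reindex_comp f h) x

theorem reindex_id : reindex (G := G) (id : ι → ι) = MonoidHom.id _ := by
  ext i g
  simp

theorem reindex_injective [Nonempty ι] {f : ι → κ} (hf : Injective f) :
    Injective (reindex (G := G) f) := by
  refine LeftInverse.injective (g := reindex (invFun f)) fun x => ?_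
  rw [reindex_reindex, invFun_comp hf, reindex_id, MonoidHom.id_apply]

theorem exists_neWord_reindex {f : ι → κ} (hf : Injective f) {i j : ι}
    (w : CoprodI.NeWord (fun _ : ι => G) i j) :
    ∃ w' : CoprodI.NeWord (fun _ : κ => G) (f i) (f j), w'.prod = reindex f w.prod := by
  induction w with
  | singleton x hx => exact ⟨.singleton x hx, by simp⟩
  | append w₁ hne w₂ ih₁ ih₂ =>
    obtain ⟨w₁', h₁⟩ := ih₁
    obtain ⟨w₂', h₂⟩ := ih₂
    exact ⟨.append w₁' (hf.ne hne) w₂', by simp [h₁, h₂]⟩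

theorem exists_neWord_prod_eq_reindex {f : ι → κ} (hf : Injective f) {x : FreePower ι G}
    (hx : x ≠ 1) :
    ∃ i j, ∃ w : CoprodI.NeWord (fun _ : κ => G) (f i) (f j), w.prod = reindex f x := by
  obtain ⟨i, j, w, rfl⟩ := exists_neWord_prod_eq hx
  exact ⟨i, j, exists_neWord_reindex hf w⟩

/-- Splitting off the maximal initial part of a reduced word without letters of index `a`. -/
theorem neWord_strip_left {f : ι → κ} {a : κ} (hf : ∀ i, i ≠ a → ∃ l, f l = i) {i j : κ}
    (w : CoprodI.NeWord (fun _ : κ => G) i j) :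
    (∃ p : FreePower ι G, w.prod = reindex f p) ∨
      ∃ (p : FreePower ι G) (u : CoprodI.NeWord (fun _ : κ => G) a j),
        w.prod = reindex f p * u.prod := by
  induction w with
  | @singleton i x hx =>
    by_cases hi : i = a
    · subst hi
      exact .inr ⟨1, .singleton x hx, by simp⟩
    · obtain ⟨l, rfl⟩ := hf i hi
      exact .inl ⟨CoprodI.of (M := fun _ : ι => G) (i := l) x, by simp⟩
  | append w₁ hne w₂ ih₁ ih₂ =>
    rcases ih₁ with ⟨p, h₁⟩ | ⟨p, u, h₁⟩
    · rcases ih₂ with ⟨q, h₂⟩ | ⟨q, u, h₂⟩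
      · exact .inl ⟨p * q, by simp [h₁, h₂]⟩
      · exact .inr ⟨p * q, u, by simp [h₁, h₂, mul_assoc]⟩
    · exact .inr ⟨p, .append u hne w₂, by simp [h₁, mul_assoc]⟩

/-- Splitting off the maximal final part of a reduced word without letters of index `a`. -/
theorem neWord_strip_right {f : ι → κ} {a : κ} (hf : ∀ i, i ≠ a → ∃ l, f l = i) {i j : κ}
    (w : CoprodI.NeWord (fun _ : κ => G) i j) :
    (∃ p : FreePower ι G, w.prod = reindex f p) ∨
      ∃ (p : FreePower ι G) (u : CoprodI.NeWord (fun _ : κ => G) i a),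
        w.prod = u.prod * reindex f p := by
  induction w with
  | @singleton i x hx =>
    by_cases hi : i = a
    · subst hi
      exact .inr ⟨1, .singleton x hx, by simp⟩
    · obtain ⟨l, rfl⟩ := hf i hi
      exact .inl ⟨CoprodI.of (M := fun _ : ι => G) (i := l) x, by simp⟩
  | append w₁ hne w₂ ih₁ ih₂ =>
    rcases ih₂ with ⟨p, h₂⟩ | ⟨p, u, h₂⟩
    · rcases ih₁ with ⟨q, h₁⟩ | ⟨q, u, h₁⟩
      · exact .inl ⟨q * p, by simp [h₁, h₂]⟩
      · exact .inr ⟨q * p, u, by simp [h₁, h₂, mul_assoc]⟩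
    · exact .inr ⟨p, .append w₁ hne u, by simp [h₂, mul_assoc]⟩

/-- Every element of a free power lies in `P' * P` or in `P' * u * P` for a reduced word `u` from
the first to the last factor, where `P` and `P'` are generated by all factors except the last and
the first one, respectively. -/
theorem doubleCoset_cases {n : ℕ} (v : FreePower (Fin (n + 2)) G) :
    (∃ p q : FreePower (Fin (n + 1)) G, v = reindex Fin.succ p * reindex Fin.castSucc q) ∨
      ∃ (p q : FreePower (Fin (n + 1)) G)
        (u : CoprodI.NeWord (fun _ : Fin (n + 2) => G) 0 (Fin.last _)),
        v = reindex Fin.succ p * u.prod * reindex Fin.castSucc q := by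
  by_cases hv : v = 1
  · exact .inl ⟨1, 1, by simp [hv]⟩
  obtain ⟨i, j, w, rfl⟩ := exists_neWord_prod_eq hv
  rcases neWord_strip_left (f := Fin.succ) (a := 0) (fun i hi => Fin.exists_succ_eq.2 hi) w with
    ⟨p, hp⟩ | ⟨p, w', hp⟩
  · exact .inl ⟨p, 1, by simp [hp]⟩
  rcases neWord_strip_right (f := Fin.castSucc) (a := Fin.last _)
    (fun i hi => Fin.exists_castSucc_eq.2 hi) w' with ⟨q, hq⟩ | ⟨q, u, hq⟩
  · exact .inl ⟨p, q, by rw [hp, hq]⟩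
  · exact .inr ⟨p, q, u, by rw [hp, hq, mul_assoc]⟩

/-- The homomorphism `P ∗ P → K` which is the inclusion of `P` on the first factor and the shift
`P → P'` followed by conjugation by `v` on the second one. -/
def shiftPair {n : ℕ} (v : FreePower (Fin (n + 2)) G) :
    FreePower Bool (FreePower (Fin (n + 1)) G) →* FreePower (Fin (n + 2)) G :=
  CoprodI.lift fun b => bif b then
    (MulAut.conj v⁻¹).toMonoidHom.comp (reindex Fin.succ) else reindex Fin.castSucc

theorem shiftPair_injective_of_neWord {n : ℕ} (u : FreePower (Fin (n + 2)) G)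
    (p q : FreePower (Fin (n + 1)) G)
    (hu : ∀ x : FreePower (Fin (n + 1)) G, x ≠ 1 →
      ∃ w : CoprodI.NeWord (fun _ : Fin (n + 2) => G) (Fin.last _) (Fin.last _),
        w.prod = u⁻¹ * reindex Fin.succ x * u) :
    Injective (shiftPair (reindex Fin.succ p * u * reindex Fin.castSucc q)) := by
  set c : FreePower (Fin (n + 2)) G := reindex Fin.castSucc q
  refine Injective.of_comp (f := MulAut.conj c) ?_
  have := coprodI_lift_injective_of_neWord
    (fun b : Bool => (MulAut.conj c).toMonoidHom.comp
      (bif b then (MulAut.conj (reindex Fin.succ p * u * c)⁻¹).toMonoidHom.comp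
        (reindex (G := G) Fin.succ) else reindex Fin.castSucc))
    (fun b : Bool => bif b then {Fin.last (n + 1)} else {Fin.last (n + 1)}ᶜ) ?_ ?_
  · convert this using 1
    rw [← MulEquiv.coe_toMonoidHom, ← MonoidHom.coe_comp]
    congr 1
    ext b x
    simp [shiftPair]
  · intro b b' h
    cases b <;> cases b' <;> simp_all
  · intro b x hx
    cases b
    · obtain ⟨i, j, w, hw⟩ := exists_neWord_prod_eq_reindex (Fin.castSucc_injective (n + 1))
        (x := q * x * q⁻¹) (by simpa using hx)
      exact ⟨_, by simp, _, by simp, w,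
        by simp [hw, c]⟩
    · obtain ⟨w, hw⟩ := hu (p⁻¹ * x * p) (by simpa [mul_assoc, inv_mul_eq_one] using hx)
      exact ⟨_, by simp, _, by simp, w, by simp [hw, mul_assoc]⟩

theorem shiftPair_injective_of_eq_mul_neWord_mul {n : ℕ} (p q : FreePower (Fin (n + 1)) G)
    (u : CoprodI.NeWord (fun _ : Fin (n + 2) => G) 0 (Fin.last _)) :
    Injective (shiftPair (reindex Fin.succ p * u.prod * reindex Fin.castSucc q)) := by
  refine shiftPair_injective_of_neWord _ _ _ fun x hx => ?_
  obtain ⟨i, j, w, hw⟩ := exists_neWord_prod_eq_reindex (Fin.succ_injective (n + 1)) hx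
  exact ⟨.append (.append u.inv (Fin.succ_ne_zero i).symm w) (Fin.succ_ne_zero j) u,
    by simp [hw]⟩

theorem shiftPair_injective_of_two (p q : FreePower (Fin 1) G) :
    Injective (shiftPair (reindex Fin.succ p * reindex Fin.castSucc q)) := by
  have := shiftPair_injective_of_neWord (n := 0) 1 p q fun x hx => by
    obtain ⟨i, j, w, hw⟩ := exists_neWord_prod_eq_reindex (Fin.succ_injective 1) hx
    obtain rfl := Subsingleton.elim i 0
    obtain rfl := Subsingleton.elim j 0
    exact ⟨w, by simpa using hw⟩
  simpa using this

/-- The action of `ℤ/k` on the free power of `k` copies of `A` by cyclic shifts. -/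
def cyclicShift (k : ℕ) (A : Type*) [Group A] :
    Multiplicative (ZMod k) →* MulAut (FreePower (ZMod k) A) where
  toFun a := MonoidHom.toMulEquiv (reindex (a.toAdd + ·)) (reindex (-a.toAdd + ·))
    (by ext i x; simp) (by ext i x; simp)
  map_one' := by
    refine MulEquiv.toMonoidHom_injective ?_
    ext i x
    simp
  map_mul' a b := by
    refine MulEquiv.toMonoidHom_injective ?_
    ext i x
    simp [add_assoc]

@[simp]
theorem cyclicShift_of {k : ℕ} {A : Type*} [Group A] (a : Multiplicative (ZMod k)) (i : ZMod k)
    (x : A) :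
    cyclicShift k A a (CoprodI.of (M := fun _ : ZMod k => A) (i := i) x) =
      CoprodI.of (M := fun _ : ZMod k => A) (i := a.toAdd + i) x :=
  reindex_of _ _ _

end FreePower

/-- Amalgamated free products exist: two embeddings of a group can be completed to a commutative
square of embeddings. -/
theorem exists_amalgam.{u} {L A B : Type u} [Group L] [Group A] [Group B] (f : L →* A) (g : L →* B)
    (hf : Injective f) (hg : Injective g) :
    ∃ (M : Type u) (_ : Group M) (a : A →* M) (b : B →* M),
      Injective a ∧ ∀ x, a (f x) = b (g x) := by
  let φ : Bool → L →* A × B := fun c =>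
    bif c then (MonoidHom.inl A B).comp f else (MonoidHom.inr A B).comp g
  have hφ : ∀ c, Injective (φ c) := by
    rintro (_ | _) x y h
    · exact hg (by simpa [φ] using h)
    · exact hf (by simpa [φ] using h)
  refine ⟨PushoutI φ, inferInstance, (PushoutI.of true).comp (MonoidHom.inl A B),
    (PushoutI.of false).comp (MonoidHom.inr A B),
    (PushoutI.of_injective hφ true).comp fun x y h => by simpa using h, fun x => ?_⟩
  exact (PushoutI.of_apply_eq_base φ true x).trans (PushoutI.of_apply_eq_base φ false x).symm

open FreePower in
/-- A free power of `k ≥ 2` factors embeds, together with the partial shift twisted by `v`, into a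
group where the twisted shift is the conjugation by an element whose `k`-th power is trivial. -/
theorem exists_root_of_shiftPair_injective.{u} {G : Type u} [Group G] {k n : ℕ} (hk : 2 ≤ k)
    (v : FreePower (Fin (n + 2)) G) (hv : Injective (shiftPair v)) :
    ∃ (M : Type u) (_ : Group M) (a : FreePower (Fin (n + 2)) G →* M) (y : M),
      Injective a ∧ y ^ k = 1 ∧ ∀ x : FreePower (Fin (n + 1)) G,
        y⁻¹ * a (reindex Fin.castSucc x) * y = a (v⁻¹ * reindex Fin.succ x * v) := by
  have : Fact (1 < k) := ⟨hk⟩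
  let P := FreePower (Fin (n + 1)) G
  let f : Bool → ZMod k := fun b => bif b then 1 else 0
  have hf : Injective f := by
    rintro (_ | _) (_ | _) h <;> simp_all [f]
  obtain ⟨M, _, a, b, ha, hab⟩ := exists_amalgam (shiftPair v)
    ((SemidirectProduct.inl (φ := cyclicShift k P)).comp (reindex f)) hv
    (SemidirectProduct.inl_injective.comp (reindex_injective hf))
  let z : Multiplicative (ZMod k) := Multiplicative.ofAdd 1
  have hz : z ^ k = 1 := by
    rw [← ofAdd_nsmul, nsmul_one, ZMod.natCast_self, ofAdd_zero]
  refine ⟨M, _, a, b (SemidirectProduct.inr z⁻¹), ha, ?_, fun x => ?_⟩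
  · rw [← map_pow, ← map_pow, inv_pow, hz, inv_one, map_one, map_one]
  · have h₀ := hab (CoprodI.of (M := fun _ : Bool => P) (i := false) x)
    have h₁ := hab (CoprodI.of (M := fun _ : Bool => P) (i := true) x)
    simp only [shiftPair, CoprodI.lift_of, cond_false, cond_true, MonoidHom.comp_apply,
      reindex_of, f] at h₀ h₁
    rw [h₀, ← map_inv, ← map_inv, inv_inv, ← map_mul, map_inv SemidirectProduct.inr, ← map_inv,
      ← map_mul, ← SemidirectProduct.inl_aut]
    simpa [z] using h₁.symm

end FreeProducts

section Relator

open FreePower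

variable {G : Type*} [Group G]

/-- The homomorphism from a free power of `G` to `F` sending the `i`-th factor to the conjugate
of `G` by `t ^ f i`. -/
def conjPower {ι : Type*} (f : ι → ℤ) : FreePower ι G →* FP G :=
  CoprodI.lift fun i => (MulAut.conj (tgen G ^ f i)⁻¹).toMonoidHom.comp (emb G)

theorem conjPower_of {ι : Type*} (f : ι → ℤ) (i : ι) (g : G) :
    conjPower f (CoprodI.of (M := fun _ : ι => G) (i := i) g) =
      (tgen G ^ f i)⁻¹ * emb G g * tgen G ^ f i := by
  simp [conjPower, -map_inv]

theorem conjPower_reindex {ι κ : Type*} (f : ι → κ) (h : κ → ℤ) (x : FreePower ι G) :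
    conjPower h (reindex f x) = conjPower (h ∘ f) x := by
  suffices (conjPower h).comp (reindex f) = conjPower (G := G) (h ∘ f) from
    DFunLike.congr_fun this x
  ext i g
  simp [conjPower_of]

theorem conjPower_add_const {ι : Type*} (f : ι → ℤ) (m : ℤ) (x : FreePower ι G) :
    conjPower (fun i => f i + m) x = (tgen G ^ m)⁻¹ * conjPower f x * tgen G ^ m := by
  suffices conjPower (fun i => f i + m) =
      (MulAut.conj (tgen G ^ m)⁻¹).toMonoidHom.comp (conjPower (G := G) f) by
    simpa [-map_inv] using DFunLike.congr_fun this x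
  ext i g
  simp [conjPower_of, zpow_add, mul_assoc, -map_inv]

theorem exists_eq_zpow_mul_conjPower (x : FP G) :
    ∃ v : FreePower ℤ G, x = tgen G ^ (expSum G x).toAdd * conjPower id v := by
  have hmul : ∀ x y : FP G,
      (∃ v : FreePower ℤ G, x = tgen G ^ (expSum G x).toAdd * conjPower id v) →
      (∃ v : FreePower ℤ G, y = tgen G ^ (expSum G y).toAdd * conjPower id v) →
      ∃ v : FreePower ℤ G, x * y = tgen G ^ (expSum G (x * y)).toAdd * conjPower id v := by
    rintro x y ⟨u, hu⟩ ⟨v, hv⟩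
    refine ⟨reindex (· + (expSum G y).toAdd) u * v, ?_⟩
    have h := conjPower_add_const id (expSum G y).toAdd u
    rw [map_mul (conjPower id), map_mul (expSum G), conjPower_reindex, toAdd_mul, zpow_add]
    change x * y = _ * (conjPower (fun i => id i + (expSum G y).toAdd) u * _)
    rw [h]
    conv_lhs => rw [hu, hv]
    group
  induction x using Monoid.Coprod.induction_on with
  | inl g =>
    refine ⟨CoprodI.of (M := fun _ : ℤ => G) (i := 0) g, ?_⟩
    simp [conjPower_of, expSum, emb]
  | inr y =>
    refine ⟨1, ?_⟩
    rw [map_one, mul_one]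
    suffices Monoid.Coprod.inr = ((zpowersHom (FP G) (tgen G)).comp
        ((expSum G).comp Monoid.Coprod.inr)) from DFunLike.congr_fun this y
    ext
    simp [expSum, tgen]
  | mul x y hx hy => exact hmul x y hx hy

theorem exists_forall_reindex_sub_eq (v : FreePower ℤ G) :
    ∃ N : ℕ, ∀ m ≥ N, ∃ u : FreePower (Fin (2 * m + 2)) G,
      reindex (fun i : Fin (2 * m + 2) => (i : ℤ) - m) u = v := by
  induction v using CoprodI.induction_on with
  | one => exact ⟨0, fun m _ => ⟨1, map_one _⟩⟩
  | of i g =>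
    refine ⟨i.natAbs, fun m hm => ⟨CoprodI.of (M := fun _ : Fin (2 * m + 2) => G)
      (i := ⟨(i + m).toNat, by omega⟩) g, ?_⟩⟩
    have : ((i + m).toNat : ℤ) - m = i := by omega
    rw [reindex_of]
    simp only [this]
  | mul x y hx hy =>
    obtain ⟨N, hN⟩ := hx
    obtain ⟨N', hN'⟩ := hy
    refine ⟨max N N', fun m hm => ?_⟩
    obtain ⟨u, rfl⟩ := hN m (le_of_max_le_left hm)
    obtain ⟨u', rfl⟩ := hN' m (le_of_max_le_right hm)
    exact ⟨u * u', map_mul _ _ _⟩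

/-- A unimodular word is conjugate to `t * v` with `v` a product of conjugates of elements of `G`
by nonnegative powers of `t`. -/
theorem Unimodular.exists_isConj {w : FP G} (hw : Unimodular w) :
    ∃ (n : ℕ) (v : FreePower (Fin (n + 2)) G),
      IsConj w (tgen G * conjPower (fun i : Fin (n + 2) => (i : ℤ)) v) := by
  obtain ⟨v, hv⟩ := exists_eq_zpow_mul_conjPower w
  obtain ⟨N, hN⟩ := exists_forall_reindex_sub_eq v
  obtain ⟨u, rfl⟩ := hN N le_rfl
  refine ⟨2 * N, u, isConj_iff.2 ⟨(tgen G ^ (N : ℤ))⁻¹, ?_⟩⟩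
  have h := conjPower_add_const (fun i : Fin (2 * N + 2) => (i : ℤ) - N) N u
  simp only [sub_add_cancel] at h
  rw [Unimodular] at hw
  rw [hw, toAdd_ofAdd, conjPower_reindex] at hv
  rw [hv, h]
  change _ * (_ * conjPower (fun i : Fin (2 * N + 2) => (i : ℤ) - N) u) * _ = _
  group

theorem exists_isConj_shiftPair_injective {w : FP G} :
    ∀ {n : ℕ} {v : FreePower (Fin (n + 2)) G},
      IsConj w (tgen G * conjPower (fun i : Fin (n + 2) => (i : ℤ)) v) →
      ∃ (n : ℕ) (v : FreePower (Fin (n + 2)) G),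
        IsConj w (tgen G * conjPower (fun i : Fin (n + 2) => (i : ℤ)) v) ∧ Injective (shiftPair v) := by
  intro n
  induction n with
  | zero =>
    intro v hw
    refine ⟨0, v, hw, ?_⟩
    rcases doubleCoset_cases v with ⟨p, q, rfl⟩ | ⟨p, q, u, rfl⟩
    · exact shiftPair_injective_of_two p q
    · exact shiftPair_injective_of_eq_mul_neWord_mul p q u
  | succ n ih =>
    intro v hw
    rcases doubleCoset_cases v with ⟨p, q, rfl⟩ | ⟨p, q, u, rfl⟩
    · refine ih (v := q * p) (hw.trans (isConj_iff.2
        ⟨tgen G * conjPower (fun i : Fin (n + 2) => (i : ℤ)) q, ?_⟩))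
      have h := conjPower_add_const (fun i : Fin (n + 2) => (i : ℤ)) 1 p
      have hsucc : ((fun i : Fin (n + 1 + 2) => (i : ℤ)) ∘ Fin.succ) =
          fun i : Fin (n + 2) => (i : ℤ) + 1 := by
        ext i
        simp
      have hcast : ((fun i : Fin (n + 1 + 2) => (i : ℤ)) ∘ Fin.castSucc) =
          fun i : Fin (n + 2) => (i : ℤ) := by
        ext i
        simp
      rw [map_mul, map_mul, conjPower_reindex, conjPower_reindex, hsucc, hcast, h]
      group
    · exact ⟨n + 1, _, hw, shiftPair_injective_of_eq_mul_neWord_mul p q u⟩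

theorem conj_pow_shift {M : Type*} [Group M] {n : ℕ} (a : FreePower (Fin (n + 1)) G →* M) (T : M)
    (hT : ∀ (i : Fin n) (g : G),
      T⁻¹ * a (CoprodI.of (M := fun _ : Fin (n + 1) => G) (i := i.castSucc) g) * T =
        a (CoprodI.of (M := fun _ : Fin (n + 1) => G) (i := i.succ) g))
    (i : Fin (n + 1)) (g : G) :
    (T ^ (i : ℕ))⁻¹ * a (CoprodI.of (M := fun _ : Fin (n + 1) => G) (i := 0) g) * T ^ (i : ℕ) =
      a (CoprodI.of (M := fun _ : Fin (n + 1) => G) (i := i) g) := by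
  induction i using Fin.induction with
  | zero => simp
  | succ i ih =>
    rw [← hT, ← ih, Fin.val_succ, Fin.val_castSucc, pow_succ]
    group

/-- The free square of `G` embeds as the product of two distinct factors of a free power. -/
theorem coprod_lift_of_injective {ι : Type*} {i j : ι} (hij : i ≠ j) :
    Injective (Monoid.Coprod.lift (CoprodI.of (M := fun _ : ι => G) (i := i))
      (CoprodI.of (M := fun _ : ι => G) (i := j))) := by
  classical
  let r : FreePower ι G →* Monoid.Coprod G G :=
    CoprodI.lift fun l => if l = i then Monoid.Coprod.inl else Monoid.Coprod.inr
  suffices r.comp (Monoid.Coprod.lift (CoprodI.of (M := fun _ : ι => G) (i := i))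
      (CoprodI.of (M := fun _ : ι => G) (i := j))) = MonoidHom.id _ from
    LeftInverse.injective (g := r) fun x => DFunLike.congr_fun this x
  ext g <;> simp [r, hij.symm]

end Relator

/-- `⟨G, G^t⟩ = G ∗ G^t` in `G̃`: the homomorphism from the free square `G ∗ G` to `G̃`
sending the first factor by `g ↦ ι̃(g)` and the second by `g ↦ t̄⁻¹ ι̃(g) t̄` is injective. -/
theorem free_square {G : Type*} [Group G] (w : FP G) (hw : Unimodular w)
    (k : ℕ) (hk : 2 ≤ k) :
    Function.Injective
      (Monoid.Coprod.lift
        ((QuotientGroup.mk' (Subgroup.normalClosure {w ^ k})).comp (emb G))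
        ((MulAut.conj ((QuotientGroup.mk' (Subgroup.normalClosure {w ^ k})) (tgen G))⁻¹).toMonoidHom.comp
          ((QuotientGroup.mk' (Subgroup.normalClosure {w ^ k})).comp (emb G)))) := by
  obtain ⟨_, _, hconj⟩ := hw.exists_isConj
  obtain ⟨n, v, hconj, hv⟩ := exists_isConj_shiftPair_injective hconj
  obtain ⟨M, _, a, y, ha, hy, hay⟩ := exists_root_of_shiftPair_injective hk v hv
  let T : M := y * (a v)⁻¹
  let Ψ : FP G →* M := Monoid.Coprod.lift
    (a.comp (CoprodI.of (M := fun _ : Fin (n + 2) => G) (i := 0))) (FreeGroup.lift fun _ => T)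
  have hΨt : Ψ (tgen G) = T := by simp [Ψ, tgen]
  have hΨG : ∀ g, Ψ (emb G g) = a (CoprodI.of (M := fun _ : Fin (n + 2) => G) (i := 0) g) :=
    fun g => by simp [Ψ, emb]
  have hT : ∀ (i : Fin (n + 1)) (g : G),
      T⁻¹ * a (CoprodI.of (M := fun _ : Fin (n + 2) => G) (i := i.castSucc) g) * T =
        a (CoprodI.of (M := fun _ : Fin (n + 2) => G) (i := i.succ) g) := by
    intro i g
    have h := hay (CoprodI.of (M := fun _ : Fin (n + 1) => G) (i := i) g)
    rw [FreePower.reindex_of, FreePower.reindex_of, map_mul, map_mul, map_inv] at h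
    calc _ = a v * (y⁻¹ * a (CoprodI.of (M := fun _ : Fin (n + 2) => G) (i := i.castSucc) g) * y)
          * (a v)⁻¹ := by simp [T, mul_assoc]
      _ = _ := by rw [h]; group
  have hΨ : Ψ.comp (conjPower fun i : Fin (n + 2) => (i : ℤ)) = a := by
    ext i g
    simpa [conjPower_of, hΨt, hΨG] using conj_pow_shift a T hT i g
  have hΨw : Ψ (w ^ k) = 1 := by
    obtain ⟨c, hc⟩ := isConj_iff.1 hconj.symm
    have hΨv : Ψ (conjPower (fun i : Fin (n + 2) => (i : ℤ)) v) = a v := DFunLike.congr_fun hΨ v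
    rw [← hc, conj_pow, map_mul, map_mul, map_pow, map_mul, hΨt, hΨv, map_inv]
    simp [T, hy]
  let Ψ' : FP G ⧸ Subgroup.normalClosure {w ^ k} →* M :=
    QuotientGroup.lift _ Ψ (Subgroup.normalClosure_le_normal (by simpa using hΨw))
  have hΨ' : ∀ x, Ψ' (QuotientGroup.mk' _ x) = Ψ x := fun x => rfl
  refine Injective.of_comp (f := Ψ') ?_
  have hcomp := ha.comp
    (coprod_lift_of_injective (G := G) (Fin.succ_ne_zero (0 : Fin (n + 1))).symm)
  convert hcomp using 1
  rw [← MonoidHom.coe_comp, ← MonoidHom.coe_comp]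
  congr 1
  ext g
  · simp only [MonoidHom.comp_apply, Monoid.Coprod.lift_apply_inl, hΨ', hΨG]
  · simp only [MonoidHom.comp_apply, Monoid.Coprod.lift_apply_inr, MulEquiv.coe_toMonoidHom,
      MulAut.conj_apply, inv_inv, map_mul Ψ', map_inv Ψ', hΨ', hΨG, hΨt]
    exact hT 0 g
end

section
/- (Linear relative isoperimetric inequality for k ≥ 3.) If w ∈ F is unimodular and k ≥ 3, then there exists a constant C > 0 with the following property: for every finite list L of elements of F, each entry of which lies in ι(G) or equals t or t⁻¹, if the product of L lies in the normal closure of w^k in F, then there exist s ≤ C · |L|_t, elements x₁, …, x_s ∈ F and signs ε₁, …, ε_s ∈ {1, −1} such that the product of L equals x₁ w^{ε₁ k} x₁⁻¹ · … · x_s w^{ε_s k} x_s⁻¹, where |L|_t denotes the number of entries of L equal to t or t⁻¹. (Hence G̃ is relatively hyperbolic with respect to G.) -/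
/-! ### Words over an HNN-like decomposition -/

set_option linter.unusedSectionVars false

namespace RelIso

/-- A token `(o, h)` is an element `h` of the base group, preceded by a stable letter if
`o = some e` (`e` is the sign of the letter). -/
abbrev Tok (H : Type*) := Option Bool × H

/-- A group `F` with a base group `H`, a stable letter and associated subgroups `A true`,
`A false` of `H` such that `T e` conjugates `A e` into `A (!e)`. -/
structure HNNData (H F : Type*) [Group H] [Group F] where
  ι : H →* F
  ι_inj : Function.Injective ι
  T : Bool → F
  T_not : ∀ e, T (!e) = (T e)⁻¹
  A : Bool → Subgroup H
  conj : ∀ e x, x ∈ A e → ∃ y ∈ A (!e), T e * ι x = ι y * T e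

namespace HNNData

variable {H F : Type*} [Group H] [Group F] (D : HNNData H F)

/-- The value of a token. -/
def tv (i : Tok H) : F := (i.1.elim 1 D.T) * D.ι i.2

/-- The value of a word. -/
def ev (l : List (Tok H)) : F := (l.map D.tv).prod

@[simp] lemma ev_nil : D.ev [] = 1 := rfl

@[simp] lemma ev_cons (i : Tok H) (l : List (Tok H)) : D.ev (i :: l) = D.tv i * D.ev l := by
  simp [ev]

@[simp] lemma ev_append (l m : List (Tok H)) : D.ev (l ++ m) = D.ev l * D.ev m := by
  simp [ev]

@[simp] lemma tv_none (h : H) : D.tv (none, h) = D.ι h := by simp [tv]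

@[simp] lemma tv_some (e : Bool) (h : H) : D.tv (some e, h) = D.T e * D.ι h := by simp [tv]

/-- A word without stable letters. -/
def Flat (l : List (Tok H)) : Prop := ∀ i ∈ l, i.1 = none

/-- The number of stable letters of a word. -/
def letters (l : List (Tok H)) : ℕ := l.countP fun i => i.1.isSome

/-- The product of the base group parts of a word. -/
def hp (l : List (Tok H)) : H := (l.map Prod.snd).prod

@[simp] lemma hp_nil : hp ([] : List (Tok H)) = 1 := rfl

@[simp] lemma hp_cons (i : Tok H) (l : List (Tok H)) : hp (i :: l) = i.2 * hp l := by
  simp [hp]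

@[simp] lemma hp_append (l m : List (Tok H)) : hp (l ++ m) = hp l * hp m := by
  simp [hp]

@[simp] lemma letters_nil : letters ([] : List (Tok H)) = 0 := rfl

@[simp] lemma letters_append (l m : List (Tok H)) :
    letters (l ++ m) = letters l + letters m := by
  simp [letters]

@[simp] lemma letters_none (h : H) (l : List (Tok H)) :
    letters ((none, h) :: l) = letters l := by
  simp [letters]

@[simp] lemma letters_some (e : Bool) (h : H) (l : List (Tok H)) :
    letters ((some e, h) :: l) = letters l + 1 := by
  simp [letters]

lemma Flat.cons_iff {i : Tok H} {l : List (Tok H)} :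
    Flat (i :: l) ↔ i.1 = none ∧ Flat l := by
  simp [Flat]

lemma flat_append {l m : List (Tok H)} : Flat (l ++ m) ↔ Flat l ∧ Flat m := by
  simp only [Flat, List.mem_append]
  constructor
  · exact fun h => ⟨fun i hi => h i (Or.inl hi), fun i hi => h i (Or.inr hi)⟩
  · rintro ⟨h1, h2⟩ i (hi | hi)
    exacts [h1 i hi, h2 i hi]

lemma letters_eq_zero {l : List (Tok H)} : letters l = 0 ↔ Flat l := by
  simp [letters, Flat, List.countP_eq_zero]

lemma Flat.ev_eq {l : List (Tok H)} (h : Flat l) : D.ev l = D.ι (hp l) := by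
  induction l with
  | nil => simp
  | cons i l ih =>
    obtain ⟨h1, h2⟩ := Flat.cons_iff.1 h
    obtain ⟨o, x⟩ := i
    obtain rfl : o = none := h1
    simp [ih h2]

/-- The first stable letter of a word. -/
lemma flat_or_split (l : List (Tok H)) :
    Flat l ∨ ∃ a e h b, Flat a ∧ l = a ++ (some e, h) :: b := by
  induction l with
  | nil => left; simp [Flat]
  | cons i l ih =>
    obtain ⟨_ | e, x⟩ := i
    · rcases ih with ih | ⟨a, e, h, b, ha, rfl⟩
      · left; exact Flat.cons_iff.2 ⟨rfl, ih⟩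
      · exact Or.inr ⟨(none, x) :: a, e, h, b, Flat.cons_iff.2 ⟨rfl, ha⟩, rfl⟩
    · exact Or.inr ⟨[], e, x, l, by simp [Flat], rfl⟩

/-- A word contains a subword `T e * h * T (!e)` with `h ∈ A e`. -/
def Pinch (l : List (Tok H)) : Prop :=
  ∃ a e h ys h' b, l = a ++ (some e, h) :: (ys ++ (some (!e), h') :: b) ∧ Flat ys ∧
    h * hp ys ∈ D.A e

variable {D}

lemma Pinch.append_left {l : List (Tok H)} (h : D.Pinch l) (m : List (Tok H)) :
    D.Pinch (m ++ l) := by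
  obtain ⟨a, e, x, ys, x', b, rfl, h1, h2⟩ := h
  exact ⟨m ++ a, e, x, ys, x', b, by simp, h1, h2⟩

lemma Pinch.append_right {l : List (Tok H)} (h : D.Pinch l) (m : List (Tok H)) :
    D.Pinch (l ++ m) := by
  obtain ⟨a, e, x, ys, x', b, rfl, h1, h2⟩ := h
  exact ⟨a, e, x, ys, x', b ++ m, by simp, h1, h2⟩

lemma Pinch.none_cons {x : H} {l : List (Tok H)} (h : D.Pinch ((none, x) :: l))
    (m : List (Tok H)) (e : Bool) (y : H) :
    D.Pinch (m ++ (some e, y) :: l) := by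
  obtain ⟨p, ep, u, ys, u', q, hpq, hp1, hp2⟩ := h
  rcases p with _ | ⟨i, p⟩
  · simp at hpq
  · simp only [List.cons_append, List.cons.injEq] at hpq
    exact ⟨m ++ (some e, y) :: p, ep, u, ys, u', q, by simp [hpq.2], hp1, hp2⟩

/-- A pinch can be removed, which decreases the number of letters. -/
lemma Pinch.exists_shorter {l : List (Tok H)} (h : D.Pinch l) :
    ∃ l', D.ev l' = D.ev l ∧ letters l' < letters l := by
  obtain ⟨a, e, x, ys, x', b, rfl, h1, h2⟩ := h
  obtain ⟨y, -, hy⟩ := D.conj e _ h2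
  refine ⟨a ++ (none, y) :: (none, x') :: b, ?_, by simp; omega⟩
  have : D.ι y = D.T e * D.ι (x * hp ys) * (D.T e)⁻¹ := by rw [hy]; group
  simp [this, D.T_not, h1.ev_eq, mul_assoc]

/-- A pinch in a concatenation either lies in one of the parts or is at the junction. -/
lemma Pinch.of_append {l m : List (Tok H)} (h : D.Pinch (l ++ m)) :
    D.Pinch l ∨ D.Pinch m ∨ ∃ a e h ys zs h' b, l = a ++ (some e, h) :: ys ∧
      m = zs ++ (some (!e), h') :: b ∧ Flat ys ∧ Flat zs ∧ h * hp ys * hp zs ∈ D.A e := by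
  obtain ⟨a, e, x, ys, x', b, hl, h1, h2⟩ := h
  rcases List.append_eq_append_iff.1 hl with ⟨c, rfl, rfl⟩ | ⟨c, rfl, hc⟩
  · exact Or.inr (Or.inl ⟨c, e, x, ys, x', b, rfl, h1, h2⟩)
  · rcases c with _ | ⟨i, c⟩
    · simp only [List.nil_append] at hc
      exact Or.inr (Or.inl ⟨[], e, x, ys, x', b, by simp [← hc], h1, h2⟩)
    · simp only [List.cons_append, List.cons.injEq] at hc
      obtain ⟨rfl, hc⟩ := hc
      rcases List.append_eq_append_iff.1 hc with ⟨d, rfl, hd⟩ | ⟨d, rfl, rfl⟩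
      · rcases d with _ | ⟨j, d⟩
        · simp only [List.nil_append] at hd
          refine Or.inr (Or.inr ⟨a, e, x, ys, [], x', b, by simp, by simp [← hd], h1, ?_, ?_⟩)
          · simp [Flat]
          · simpa using h2
        · simp only [List.cons_append, List.cons.injEq] at hd
          obtain ⟨rfl, hd⟩ := hd
          exact Or.inl ⟨a, e, x, ys, x', d, rfl, h1, h2⟩
      · obtain ⟨h3, h4⟩ := flat_append.1 h1
        exact Or.inr (Or.inr ⟨a, e, x, c, d, x', b, rfl, rfl, h3, h4, by
          simpa [mul_assoc] using h2⟩)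

/-- A pinch does not pass through a letter. -/
lemma Pinch.of_append_append {l m n : List (Tok H)} (h : D.Pinch (l ++ (m ++ n)))
    (hm : ¬ Flat m) : D.Pinch (l ++ m) ∨ D.Pinch (m ++ n) := by
  rcases h.of_append with h | h | ⟨a, e, x, ys, zs, x', b, rfl, hz, h1, h2, h3⟩
  · exact Or.inl (h.append_right m)
  · exact Or.inr h
  · left
    rcases List.append_eq_append_iff.1 hz with ⟨c, rfl, -⟩ | ⟨c, rfl, hc⟩
    · exact absurd (flat_append.1 h2).1 hm
    · rcases c with _ | ⟨j, c⟩
      · exact absurd (by simpa using h2) hm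
      · simp only [List.cons_append, List.cons.injEq] at hc
        obtain ⟨rfl, -⟩ := hc
        exact ⟨a, e, x, ys ++ zs, x', c, by simp, flat_append.2 ⟨h1, h2⟩, by
          simpa [mul_assoc] using h3⟩

end HNNData

/-- An HNN-like decomposition in which normal forms behave as in an HNN extension and in which
the associated subgroups are malnormal. -/
structure HNNPres (H F : Type*) [Group H] [Group F] extends HNNData H F where
  gen : ∀ f : F, ∃ l : List (Tok H), toHNNData.ev l = f
  britton : ∀ (a : List (Tok H)) (e : Bool) (h : H) (b l : List (Tok H)),
    ¬ toHNNData.Pinch (a ++ (some e, h) :: b) → ¬ toHNNData.Pinch l → HNNData.Flat a →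
    toHNNData.ev (a ++ (some e, h) :: b) = toHNNData.ev l →
    ∃ a' h' b', l = a' ++ (some e, h') :: b' ∧ HNNData.Flat a' ∧
      (HNNData.hp a')⁻¹ * HNNData.hp a ∈ A (!e)
  malnormal : ∀ e, ∀ p ∈ A e, p ≠ 1 → ∀ h, h * p * h⁻¹ ∈ A e → h ∈ A e

namespace HNNPres

open HNNData

variable {H F : Type*} [Group H] [Group F] (D : HNNPres H F)

/-- The letters of two reduced words with the same value correspond to each other. -/
lemma transfer (n : ℕ) : ∀ (l l' : List (Tok H)), letters l ≤ n → ¬ D.Pinch l → ¬ D.Pinch l' →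
    D.ev l = D.ev l' → ∀ a e h b, l = a ++ (some e, h) :: b →
    ∃ a' h' b', l' = a' ++ (some e, h') :: b' ∧ ∃ x ∈ D.A (!e), D.ev a = D.ev a' * D.ι x := by
  induction n with
  | zero =>
    rintro l l' hn - - - a e h b rfl
    simp at hn
  | succ n ih =>
    intro l l' hn hl hl' hll a e h b hab
    rcases flat_or_split l with hfl | ⟨a0, e0, h0, b0, ha0, rfl⟩
    · subst hab
      have := (Flat.cons_iff.1 (flat_append.1 hfl).2).1
      simp at this
    obtain ⟨a1, h1, b1, rfl, ha1, hx⟩ := D.britton a0 e0 h0 b0 l' hl hl' ha0 hll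
    rcases List.append_eq_append_iff.1 hab with ⟨c, rfl, hc⟩ | ⟨c, rfl, hc⟩
    · rcases c with _ | ⟨i, c⟩
      · simp only [List.nil_append, List.cons.injEq, Prod.mk.injEq, Option.some.injEq] at hc
        obtain ⟨⟨rfl, rfl⟩, rfl⟩ := hc
        refine ⟨a1, h1, b1, rfl, _, hx, ?_⟩
        simp [ha0.ev_eq, ha1.ev_eq]
      · simp only [List.cons_append, List.cons.injEq] at hc
        obtain ⟨rfl, rfl⟩ := hc
        obtain ⟨y, -, hy⟩ := D.conj (!e0) _ hx
        rw [D.T_not] at hy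
        have hy' : D.ι (hp a0) * D.T e0 = D.ι (hp a1) * D.T e0 * D.ι y := by
          have : D.ι y = (D.T e0)⁻¹ * D.ι ((hp a1)⁻¹ * hp a0) * D.T e0 := by
            rw [hy]; group
          rw [this]; simp [mul_assoc]
        obtain ⟨a', h', b', hab', x, hx', hxe⟩ := ih
          ((none, y * h0) :: (c ++ (some e, h) :: b)) ((none, h1) :: b1) (by
            simp at hn ⊢; omega) (fun hP => hl (hP.none_cons _ _ _))
            (fun hP => hl' (hP.none_cons _ _ _)) (by
            have h2 : D.ι (hp a0) * D.T e0 * (D.ι h0 * D.ev (c ++ (some e, h) :: b)) =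
              D.ι (hp a1) * D.T e0 * (D.ι h1 * D.ev b1) := by
              simpa [ha0.ev_eq, ha1.ev_eq, mul_assoc] using hll
            rw [hy'] at h2
            simp only [mul_assoc] at h2
            have h3 := mul_left_cancel (mul_left_cancel h2)
            simp only [ev_cons, tv_none, map_mul, mul_assoc]
            exact h3) ((none, y * h0) :: c) e h b (by simp)
        · rcases a' with _ | ⟨i, a'⟩
          · simp at hab'
          · simp only [List.cons_append, List.cons.injEq] at hab'
            obtain ⟨rfl, rfl⟩ := hab'
            refine ⟨a1 ++ (some e0, h1) :: a', h', b', by simp, x, hx', ?_⟩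
            simp only [ev_append, ev_cons, tv_some, tv_none, ha0.ev_eq, ha1.ev_eq] at hxe ⊢
            calc _ = D.ι (hp a0) * D.T e0 * (D.ι h0 * D.ev c) := by group
              _ = D.ι (hp a1) * D.T e0 * (D.ι (y * h0) * D.ev c) := by
                rw [hy']; simp [mul_assoc]
              _ = _ := by rw [hxe]; group
    · rcases c with _ | ⟨i, c⟩
      · simp only [List.nil_append, List.cons.injEq, Prod.mk.injEq, Option.some.injEq] at hc
        obtain ⟨⟨rfl, rfl⟩, rfl⟩ := hc
        refine ⟨a1, h1, b1, rfl, _, hx, ?_⟩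
        have := ha0.ev_eq D.toHNNData
        simp only [List.append_nil] at this ha0 ⊢
        simp [ha0.ev_eq, ha1.ev_eq]
      · simp only [List.cons_append, List.cons.injEq] at hc
        obtain ⟨rfl, rfl⟩ := hc
        simpa using (Flat.cons_iff.1 (flat_append.1 ha0).2).1

/-- A reduced word representing an element of the base group has no stable letters. -/
lemma flat_of_ev_eq_one {l : List (Tok H)} (hl : ¬ D.Pinch l) (h : D.ev l = 1) : Flat l := by
  rcases flat_or_split l with hfl | ⟨a0, e0, h0, b0, ha0, rfl⟩
  · exact hfl
  · obtain ⟨a1, h1, b1, hh, -⟩ := D.britton a0 e0 h0 b0 [] hl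
      (by rintro ⟨a, e, x, ys, x', b, hh, -⟩; simp at hh) ha0 (by simpa using h)
    simp at hh

end HNNPres

end RelIso

/-! ### Relators and area -/

namespace RelIso

open scoped Pointwise
open HNNData

/-- Combinatorial data of a cyclic relator with `K` letters, of which at least `k` are followed by a
distinguished corner. The type `Λ` consists of the letters of the relator (`sgn = true`) and of its
inverse (`sgn = false`); `g a` is the base group element following the letter `a`, `nxt` is the
cyclic successor, `inv` is the same letter read backwards, `isC a` says that the corner after `a`
is distinguished and `ew` is an auxiliary weight of letters. -/
structure Relator (H F : Type*) [Group H] [Group F] extends HNNPres H F where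
  Λ : Type
  nxt : Λ → Λ
  inv : Λ → Λ
  δ : Λ → Bool
  sgn : Λ → Bool
  isC : Λ → Bool
  ew : Λ → ℤ
  g : Λ → H
  K : ℕ
  K_pos : 0 < K
  k : ℕ
  nxt_K : ∀ a, nxt^[K] a = a
  k_le : ∀ a, k ≤ ∑ i ∈ Finset.range K, if isC (nxt^[i] a) then 1 else 0
  inv_inv : ∀ a, inv (inv a) = a
  δ_inv : ∀ a, δ (inv a) = !δ a
  ew_inv : ∀ a, ew (inv a) = -ew a
  sgn_inv : ∀ a, sgn (inv a) = !sgn a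
  sgn_nxt : ∀ a, sgn (nxt a) = sgn a
  nxt_inv_nxt : ∀ a, nxt (inv (nxt a)) = inv a
  isC_inv_nxt : ∀ a, isC (inv (nxt a)) = isC a
  g_inv_nxt : ∀ a, g (inv (nxt a)) = (g a)⁻¹
  δ_nxt : ∀ a, δ (nxt a) = if isC a then δ a else !δ a
  g_notMem : ∀ a, isC a = false → g a ∉ A (δ a)
  ew_nxt_of_isC : ∀ a, isC a → ew (nxt a) = 1 ∨ ∀ e, A e = ⊥
  ew_nxt_of_not_isC : ∀ a, isC a = false → ew (nxt a) = 0 ∨ ew (nxt a) = -1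
  ew_consecutive : ∀ a, isC a = false → ew a = 1 → ew (nxt a) ≠ -1
  eq_inv_nxt : ∀ a b, isC a → isC b → δ b = !δ (nxt a) → b = inv (nxt a)

namespace Relator

variable {H F : Type*} [Group H] [Group F] (R : Relator H F)

/-- A corner of an annotated word: the corner after a letter of a relator, or an arbitrary element
of the base group preceded by a letter. -/
abbrev Corner := R.Λ ⊕ (Bool × H)

/-- An item of an annotated word: a corner preceded by a stable letter (`none`) or by an element of
the base group. -/
abbrev Item := Option H × R.Corner

variable {R}

/-- The sign of the letter in front of a corner. -/
def dir : R.Corner → Bool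
  | .inl a => R.δ a
  | .inr b => b.1

/-- The base group element of a corner. -/
def val : R.Corner → H
  | .inl a => R.g a
  | .inr b => b.2

/-- The token of an item. -/
def tok : R.Item → Tok H
  | (none, c) => (some (dir c), val c)
  | (some x, c) => (none, x * val c)

variable (R)

/-- The value of an annotated word. -/
def evI (U : List R.Item) : F := R.ev (U.map tok)

/-- `n` consecutive letters of a relator. -/
def face : R.Λ → ℕ → List R.Item
  | _, 0 => []
  | a, n + 1 => (none, .inl a) :: face (R.nxt a) n

/-- The relator read from a given letter. -/
def ρ (a : R.Λ) : F := R.evI (R.face a R.K)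

@[simp] lemma evI_nil : R.evI [] = 1 := rfl

@[simp] lemma evI_cons (i : R.Item) (l : List R.Item) :
    R.evI (i :: l) = R.tv (tok i) * R.evI l := by
  simp [evI]

@[simp] lemma evI_append (l m : List R.Item) : R.evI (l ++ m) = R.evI l * R.evI m := by
  simp [evI]

lemma face_succ' (a : R.Λ) (n : ℕ) :
    R.face a (n + 1) = R.face a n ++ [(none, .inl (R.nxt^[n] a))] := by
  induction n generalizing a with
  | zero => rfl
  | succ n ih =>
    rw [face, ih (R.nxt a)]
    simp [face]

/-- The value of a letter of the relator together with the corner behind it. -/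
lemma ρ_mul (a : R.Λ) : R.ρ a * (R.T (R.δ a) * R.ι (R.g a)) =
    R.T (R.δ a) * R.ι (R.g a) * R.ρ (R.nxt a) := by
  have h : R.face a (R.K + 1) = R.face a R.K ++ [(none, .inl a)] := by
    rw [face_succ', R.nxt_K]
  have h2 := congrArg R.evI h
  rw [face, evI_append, evI_cons] at h2
  simpa [tok, ρ, dir, val] using h2.symm

lemma ρ_nxt (a : R.Λ) : R.ρ (R.nxt a) = (R.T (R.δ a) * R.ι (R.g a))⁻¹ * R.ρ a *
    (R.T (R.δ a) * R.ι (R.g a)) := by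
  rw [mul_assoc, ρ_mul]; group

/-- Products of letters of the relator read backwards. -/
lemma evI_face_inv (a : R.Λ) (n : ℕ) :
    R.T (R.δ (R.nxt^[n] a)) * R.evI (R.face (R.inv (R.nxt^[n] a)) n)
      = (R.evI (R.face a n))⁻¹ * R.T (R.δ a) := by
  induction n with
  | zero => simp [face]
  | succ n ih =>
    have hs : R.face a (n + 1) = R.face a n ++ [(none, .inl (R.nxt^[n] a))] := face_succ' ..
    rw [hs, evI_append]
    simp only [Function.iterate_succ_apply', face, evI_cons, tok, dir, val, R.nxt_inv_nxt,
      R.g_inv_nxt, R.δ_inv, tv_some, R.T_not, map_inv, evI_nil, mul_one, mul_inv_rev]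
    rw [← mul_assoc, ← mul_assoc, mul_inv_cancel, one_mul]
    have := congrArg (fun z => (R.ι (R.g (R.nxt^[n] a)))⁻¹ * (R.T (R.δ (R.nxt^[n] a)))⁻¹ * z) ih
    simp only [mul_assoc, inv_mul_cancel_left] at this ⊢
    exact this

lemma T_mul_ρ_inv (a : R.Λ) : R.T (R.δ a) * R.ρ (R.inv a) * (R.T (R.δ a))⁻¹ = (R.ρ a)⁻¹ := by
  have := R.evI_face_inv a R.K
  rw [R.nxt_K] at this
  rw [ρ, this, ρ, mul_inv_cancel_right]

lemma T_mul_ρ_inv' (a : R.Λ) : R.T (R.δ a) * (R.ρ (R.inv a))⁻¹ * (R.T (R.δ a))⁻¹ = R.ρ a := by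
  rw [← inv_inj, ← R.T_mul_ρ_inv a]; group

/-- The conjugates of the relator and its inverse, and the identity. -/
def conjs : Set F := {f | f = 1 ∨ ∃ x a, f = x * R.ρ a * x⁻¹}

/-- The elements of area at most `n`. -/
def N (n : ℕ) : Set F := R.conjs ^ n

variable {R}

lemma N_mul {m n : ℕ} {a b : F} (ha : a ∈ R.N m) (hb : b ∈ R.N n) : a * b ∈ R.N (m + n) := by
  rw [N, pow_add]; exact Set.mul_mem_mul ha hb

lemma one_mem_conjs : (1 : F) ∈ R.conjs := Or.inl rfl

lemma one_mem_N (n : ℕ) : (1 : F) ∈ R.N n := by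
  rw [N]
  induction n with
  | zero => simp
  | succ n ih => rw [pow_succ]; exact ⟨1, ih, 1, one_mem_conjs, by simp⟩

lemma mem_N_zero {a : F} : a ∈ R.N 0 ↔ a = 1 := by simp [N]

lemma N_mono {m n : ℕ} (h : m ≤ n) {a : F} (ha : a ∈ R.N m) : a ∈ R.N n := by
  obtain ⟨k, rfl⟩ := Nat.exists_eq_add_of_le h
  simpa using N_mul ha (one_mem_N k)

lemma conjs_conj {f : F} (h : f ∈ R.conjs) (x : F) : x * f * x⁻¹ ∈ R.conjs := by
  rcases h with rfl | ⟨y, a, rfl⟩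
  · left; simp
  · right; exact ⟨x * y, a, by group⟩

lemma conjs_inv {f : F} (h : f ∈ R.conjs) : f⁻¹ ∈ R.conjs := by
  rcases h with rfl | ⟨y, a, rfl⟩
  · left; simp
  · right; exact ⟨y * R.T (R.δ a), R.inv a, by
      have := R.T_mul_ρ_inv a
      calc _ = y * (R.ρ a)⁻¹ * y⁻¹ := by group
        _ = _ := by rw [← this]; group⟩

lemma N_conj {n : ℕ} {f : F} (h : f ∈ R.N n) (x : F) : x * f * x⁻¹ ∈ R.N n := by
  induction n generalizing f with
  | zero => rw [mem_N_zero] at h ⊢; simp [h]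
  | succ n ih =>
    rw [N, pow_succ] at h ⊢
    obtain ⟨a, ha, b, hb, rfl⟩ := h
    exact ⟨_, ih ha, _, conjs_conj hb x, by simp only; group⟩

lemma N_conj' {n : ℕ} {f : F} (h : f ∈ R.N n) (x : F) : x⁻¹ * f * x ∈ R.N n := by
  simpa using N_conj h x⁻¹

lemma N_inv {n : ℕ} {f : F} (h : f ∈ R.N n) : f⁻¹ ∈ R.N n := by
  have h1 : R.conjs⁻¹ = R.conjs := by
    ext f
    exact ⟨fun h => by simpa using conjs_inv (R := R) h, fun h => conjs_inv h⟩
  have h2 : (R.N n)⁻¹ = R.N n := by rw [N, ← inv_pow, h1]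
  rw [← h2]; simpa using h

lemma ρ_mem_N (a : R.Λ) : R.ρ a ∈ R.N 1 := by
  rw [N, pow_one]; exact Or.inr ⟨1, a, by simp⟩

end Relator
end RelIso

/-! ### Annotated words and their weights -/

namespace RelIso
namespace Relator

open HNNData

variable {H F : Type*} [Group H] [Group F] {R : Relator H F}

/-- The condition that an item may follow a corner. -/
def Step : R.Corner → R.Item → Prop
  | .inl a, (none, .inl b) => b = R.nxt a
  | .inl _, (none, .inr _) => False
  | .inr _, (none, .inl _) => False
  | .inl a, (some x, .inl b) =>
    R.δ b = (!R.δ (R.nxt a)) ∧ x ∈ R.A (R.δ b) ∧ (b = R.inv (R.nxt a) → x ≠ 1)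
  | _, _ => True

/-- A list of items may follow a corner. -/
def Valid : R.Corner → List R.Item → Prop
  | _, [] => True
  | c, i :: l => Step c i ∧ Valid i.2 l

/-- The weight of a corner. -/
def cw : R.Corner → ℤ
  | .inl a => if R.isC a then 0 else 1
  | .inr _ => 2

open scoped Classical in
/-- The weight of the edge between two corners. -/
noncomputable def lw : R.Corner → R.Item → ℤ
  | .inl a, (some _, .inl b) => if b = R.inv (R.nxt a) then R.ew (R.nxt a) else 0
  | _, _ => 0

/-- The total weight of the steps of a list of items following a corner. -/
noncomputable def swt : R.Corner → List R.Item → ℤ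
  | _, [] => 0
  | c, i :: l => cw c + lw c i + swt i.2 l

/-- The last corner of a list of items following a corner. -/
def lastc : R.Corner → List R.Item → R.Corner
  | c, [] => c
  | _, i :: l => lastc i.2 l

lemma valid_append (c : R.Corner) (l m : List R.Item) :
    Valid c (l ++ m) ↔ Valid c l ∧ Valid (lastc c l) m := by
  induction l generalizing c with
  | nil => simp [Valid, lastc]
  | cons i l ih => simp [Valid, lastc, ih, and_assoc]

lemma swt_append (c : R.Corner) (l m : List R.Item) :
    swt c (l ++ m) = swt c l + swt (lastc c l) m := by
  induction l generalizing c with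
  | nil => simp [swt, lastc]
  | cons i l ih => simp [swt, lastc, ih, add_assoc]

lemma lastc_append (c : R.Corner) (l m : List R.Item) :
    lastc c (l ++ m) = lastc (lastc c l) m := by
  induction l generalizing c with
  | nil => simp [lastc]
  | cons i l ih => simp [lastc, ih]

lemma step_weight_nonneg {c : R.Corner} {i : R.Item} (h : Step c i) : 0 ≤ cw c + lw c i := by
  obtain ⟨o, d⟩ := i
  rcases c with a | a
  · rcases o with _ | x
    · simp only [lw, cw]; split <;> simp
    rcases d with b | b
    · simp only [cw, lw]
      split_ifs with h1 h2
      · rcases R.ew_nxt_of_isC a h1 with h3 | h3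
        · omega
        · obtain ⟨-, h4, h5⟩ := h
          rw [h3, Subgroup.mem_bot] at h4
          exact absurd h4 (h5 h2)
      · simp
      · rcases R.ew_nxt_of_not_isC a (by simpa using h1) with h3 | h3 <;> omega
      · simp
    · simp only [lw, cw]; split <;> simp
  · simp [lw, cw]

lemma swt_nonneg {c : R.Corner} {l : List R.Item} (h : Valid c l) : 0 ≤ swt c l := by
  induction l generalizing c with
  | nil => simp [swt]
  | cons i l ih =>
    have := step_weight_nonneg h.1
    have := ih h.2
    simp only [swt]; omega

/-- Annotated words without letters. -/
def FlatI (l : List R.Item) : Prop := ∀ i ∈ l, i.1 ≠ none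

/-- Corners coming from relators. -/
def IsFace (c : R.Corner) : Prop := c.isLeft

/-- Distinguished corners. -/
def isCc : R.Corner → ℕ
  | .inl a => if R.isC a then 1 else 0
  | .inr _ => 0

/-- The number of distinguished corners of a path, not counting the last one. -/
def cnt : R.Corner → List R.Item → ℕ
  | _, [] => 0
  | c, i :: l => isCc c + cnt i.2 l

lemma isCc_le_step {a : R.Λ} {x : H} {b : R.Λ} (h : Step (.inl a) (some x, .inl b)) :
    (isCc (.inl b : R.Corner) : ℤ) ≤ cw (.inl a : R.Corner) + lw (.inl a) (some x, .inl b) := by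
  have h0 := step_weight_nonneg h
  by_cases hb : R.isC b
  swap
  · simpa [isCc, hb] using h0
  obtain ⟨h1, h2, h3⟩ := h
  by_cases ha : R.isC a
  · have hba := R.eq_inv_nxt a b ha hb h1
    rcases R.ew_nxt_of_isC a ha with h4 | h4
    · simp [isCc, cw, lw, ha, hba, h4]; split <;> simp
    · rw [h4, Subgroup.mem_bot] at h2
      exact absurd h2 (h3 hba)
  · have hba : b ≠ R.inv (R.nxt a) := by
      rintro rfl
      rw [R.isC_inv_nxt] at hb; exact ha hb
    simp [isCc, cw, lw, ha, hb, hba]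

lemma cnt_le_swt (l : List R.Item) (a : R.Λ) (b : R.Λ) (hl : FlatI l)
    (hf : ∀ i ∈ l, IsFace i.2) (h : Valid (.inl a) l) (hb : lastc (.inl a) l = .inl b) :
    (cnt (.inl a) l + isCc (.inl b : R.Corner) : ℤ) ≤ swt (.inl a) l + isCc (.inl a : R.Corner) ∧
    R.δ b = (R.δ a ^^ decide (Odd (cnt (.inl a) l))) := by
  induction l generalizing a with
  | nil =>
    simp only [lastc, Sum.inl.injEq] at hb
    subst hb
    simp [cnt, swt]
  | cons i l ih =>
    obtain ⟨_ | x, a' | a'⟩ := i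
    · exact absurd rfl (hl _ List.mem_cons_self)
    · exact absurd rfl (hl _ List.mem_cons_self)
    swap
    · simp [IsFace] at hf
    obtain ⟨h1, h2⟩ := ih a' (fun i hi => hl i (List.mem_cons_of_mem _ hi))
      (fun i hi => hf i (List.mem_cons_of_mem _ hi)) h.2 hb
    have h3 := isCc_le_step h.1
    refine ⟨by simp only [cnt, swt]; push_cast; omega, ?_⟩
    rw [h2, h.1.1, R.δ_nxt]
    simp only [cnt, isCc]
    split_ifs
    · simp only [add_comm 1, Nat.odd_add_one]
      cases R.δ a <;> by_cases h : Odd (cnt (Sum.inl a') l) <;> simp [h]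
    · simp

/-- Two consecutive steps between ordinary corners do not both have weight zero. -/
lemma one_le_two_steps {a b : R.Λ} {x y : H} {c : R.Corner} (ha : R.isC a = false)
    (hb : R.isC b = false) (h1 : Step (.inl a) (some x, .inl b))
    (h2 : Step (.inl b) (some y, c)) :
    1 ≤ cw (.inl a : R.Corner) + lw (.inl a) (some x, .inl b) +
      (cw (.inl b : R.Corner) + lw (.inl b) (some y, c)) := by
  have h3 := step_weight_nonneg h1
  have h4 := step_weight_nonneg h2
  by_contra hlt
  have h5 : cw (.inl a : R.Corner) + lw (.inl a) (some x, .inl b) = 0 := by omega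
  have h6 : cw (.inl b : R.Corner) + lw (.inl b) (some y, c) = 0 := by omega
  rcases c with c | c
  swap
  · simp [cw, lw, hb] at h6
  simp only [cw, ha, lw, Bool.false_eq_true, if_false] at h5
  simp only [cw, hb, lw, Bool.false_eq_true, if_false] at h6
  split_ifs at h5 with h7
  swap
  · omega
  split_ifs at h6
  swap
  · omega
  have := R.ew_inv (R.nxt a)
  rw [← h7] at this
  exact R.ew_consecutive b hb (by omega) (by omega)

/-- If a path passes a corner of weight two, then it has weight at least two. -/
lemma two_le_swt_of_not_isFace {c : R.Corner} {l : List R.Item} (hl : l ≠ []) (h : Valid c l)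
    (hc : ¬ IsFace c ∨ ∃ m i n, l = m ++ i :: n ∧ n ≠ [] ∧ ¬ IsFace i.2) : 2 ≤ swt c l := by
  have key : ∀ {c : R.Corner} {l : List R.Item}, l ≠ [] → Valid c l → ¬ IsFace c →
      2 ≤ swt c l := by
    intro c l hl h hc
    rcases l with _ | ⟨i, l⟩
    · exact absurd rfl hl
    rcases c with c | c
    · simp [IsFace] at hc
    · have := swt_nonneg h.2
      simp only [swt, cw, lw]; omega
  rcases hc with hc | ⟨m, i, n, rfl, hn, hi⟩
  · exact key hl h hc
  · rw [valid_append] at h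
    rw [swt_append, swt]
    have h1 := swt_nonneg h.1
    have h2 := step_weight_nonneg h.2.1
    have h3 := key hn h.2.2 hi
    omega

/-- A closed path around a vertex has weight at least two. -/
lemma two_le_swt_closed (c : R.Corner) (ys : List R.Item) (x : H) (hf : FlatI ys)
    (hv : Valid c (ys ++ [(some x, c)])) (h1 : val c * hp (ys.map tok) * x = 1) :
    2 ≤ swt c (ys ++ [(some x, c)]) := by
  by_cases hs : ¬ IsFace c ∨ ∃ i ∈ ys, ¬ IsFace i.2
  · refine two_le_swt_of_not_isFace (by simp) hv (hs.imp_right ?_)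
    rintro ⟨i, hi, hic⟩
    obtain ⟨m, n, rfl⟩ := List.append_of_mem hi
    exact ⟨m, i, n ++ [(some x, c)], by simp, by simp, hic⟩
  push Not at hs
  obtain ⟨hc, hys⟩ := hs
  rcases c with a | a
  swap
  · simp [IsFace] at hc
  have hf' : FlatI (ys ++ [(some x, (.inl a : R.Corner))]) := by
    intro i hi
    rcases List.mem_append.1 hi with hi | hi
    · exact hf i hi
    · rw [List.mem_singleton.1 hi]; simp
  obtain ⟨h2, h3⟩ := cnt_le_swt _ a a hf' (by
    intro i hi
    rcases List.mem_append.1 hi with hi | hi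
    · exact hys i hi
    · rw [List.mem_singleton.1 hi]; exact hc) hv (by simp [lastc_append, lastc])
  have hodd : ¬ Odd (cnt (.inl a) (ys ++ [(some x, (.inl a : R.Corner))])) := by
    intro ho
    rw [decide_eq_true ho] at h3
    cases h : R.δ a <;> simp [h] at h3
  rw [Nat.not_odd_iff_even] at hodd
  by_cases h0 : cnt (.inl a) (ys ++ [(some x, (.inl a : R.Corner))]) = 0
  swap
  · have : 2 ≤ cnt (.inl a) (ys ++ [(some x, (.inl a : R.Corner))]) := by
      obtain ⟨k, hk⟩ := hodd
      omega
    omega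
  have isC_of : ∀ b : R.Λ, isCc (.inl b : R.Corner) = 0 → R.isC b = false := by
    intro b hb
    by_contra hb'
    simp [isCc, hb'] at hb
  have item : ∀ i ∈ ys, ∃ y b, i = (some y, .inl b) := by
    rintro ⟨_ | y, b | b⟩ hi
    · exact absurd rfl (hf _ hi)
    · exact absurd rfl (hf _ hi)
    · exact ⟨y, b, rfl⟩
    · simpa [IsFace] using hys _ hi
  rcases ys with _ | ⟨i, ys⟩
  · simp only [List.nil_append, cnt] at h0
    have ha := isC_of a (by omega)
    exfalso
    refine R.g_notMem a ha ?_
    have h4 : R.g a = x⁻¹ := by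
      rw [eq_inv_iff_mul_eq_one]; simpa [val] using h1
    rw [h4]
    exact inv_mem hv.1.2.1
  obtain ⟨y, b, rfl⟩ := item i List.mem_cons_self
  simp only [List.cons_append, cnt] at h0
  have ha := isC_of a (by omega)
  rcases ys with _ | ⟨j, ys⟩
  · simp only [List.nil_append, cnt] at h0
    have hb := isC_of b (by omega)
    have hab : R.δ b = R.δ a := by
      rw [hv.1.1, R.δ_nxt]; simp [ha]
    obtain ⟨s1, s2, -⟩ := hv
    simp only [val, List.map_cons, tok, List.map_nil, HNNData.hp_cons, HNNData.hp_nil,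
      mul_one] at h1
    have e1 : b ≠ R.inv (R.nxt a) := by
      rintro rfl
      rw [R.g_inv_nxt] at h1
      refine R.g_notMem a ha (R.malnormal _ y (by rw [← hab]; exact s1.2.1) (s1.2.2 rfl) _ ?_)
      have : R.g a * y * (R.g a)⁻¹ = x⁻¹ := by
        rw [eq_inv_iff_mul_eq_one]; simpa [mul_assoc] using h1
      rw [this]
      exact inv_mem s2.2.1
    have e2 : a ≠ R.inv (R.nxt b) := by
      intro hh
      have hg : R.g a = (R.g b)⁻¹ := by rw [← R.g_inv_nxt, ← hh]
      rw [hg] at h1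
      refine R.g_notMem b hb (R.malnormal _ x (by rw [hab]; exact s2.2.1) (s2.2.2 hh) _ ?_)
      have : R.g b * x * (R.g b)⁻¹ = y⁻¹ := by
        rw [eq_inv_iff_mul_eq_one]
        have h5 : R.g b * x = y⁻¹ * R.g b := by
          have : x = ((R.g b)⁻¹ * (y * R.g b))⁻¹ := eq_inv_of_mul_eq_one_right h1
          rw [this]; group
        rw [h5]; group
      rw [this]
      exact inv_mem s1.2.1
    simp [swt, cw, lw, ha, hb, e1, e2]
  obtain ⟨z, d, rfl⟩ := item j (by simp)
  simp only [List.cons_append, cnt] at h0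
  have hb := isC_of b (by omega)
  rcases ys with _ | ⟨k, ys⟩
  · simp only [List.nil_append, cnt] at h0
    have hd := isC_of d (by omega)
    obtain ⟨s1, s2, s3, -⟩ := hv
    have t1 := one_le_two_steps ha hb s1 s2
    have t2 := one_le_two_steps hb hd s2 s3
    have t3 := one_le_two_steps hd ha s3 s1
    simp only [List.cons_append, List.nil_append, swt]
    omega
  obtain ⟨u, f, rfl⟩ := item k (by simp)
  simp only [List.cons_append, cnt] at h0
  have hd := isC_of d (by omega)
  simp only [List.cons_append] at hv
  obtain ⟨s1, s2, s3, s4⟩ := hv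
  have hl : ∃ i l, ys ++ [(some x, .inl a)] = i :: l ∧ i.1 ≠ none := by
    rcases ys with _ | ⟨i, ys⟩
    · exact ⟨_, _, rfl, by simp⟩
    · exact ⟨i, _, rfl, hf i (by simp)⟩
  obtain ⟨⟨_ | o, i⟩, l, hil, hi⟩ := hl
  · exact absurd rfl hi
  have hfC : R.isC f = false := by
    rw [hil] at h0
    simp only [cnt] at h0
    exact isC_of f (by omega)
  rw [hil] at s4
  have t1 := one_le_two_steps ha hb s1 s2
  have t2 := one_le_two_steps hd hfC s3 s4.1
  have t3 : 0 ≤ swt i l := swt_nonneg s4.2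
  simp only [List.cons_append, swt, hil]
  omega

end Relator
end RelIso

/-! ### Marked words and moves -/

namespace RelIso
namespace Relator

open HNNData

variable {H F : Type*} [Group H] [Group F] (R : Relator H F)

/-- The value of an item in a marked annotated word: a marked letter of a relator is preceded by
the inverse of this relator. -/
def mv : R.Item × Bool → F
  | ((none, .inl a), true) => (R.ρ a)⁻¹ * R.tv (tok (none, .inl a))
  | (i, _) => R.tv (tok i)

/-- The value of a marked annotated word. -/
def evM (M : List (R.Item × Bool)) : F := (M.map R.mv).prod

/-- The number of effective marks of a given sign at an item. -/
def mc (s : Bool) : R.Item × Bool → ℕ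
  | ((none, .inl a), true) => if R.sgn a = s then 1 else 0
  | _ => 0

/-- The number of effective marks of a given sign. -/
def mcs (s : Bool) (M : List (R.Item × Bool)) : ℕ := (M.map (R.mc s)).sum

/-- The marking without marks. -/
def unmarked (l : List R.Item) : List (R.Item × Bool) := l.map fun i => (i, false)

@[simp] lemma evM_nil : R.evM [] = 1 := rfl

@[simp] lemma evM_cons (i : R.Item × Bool) (M : List (R.Item × Bool)) :
    R.evM (i :: M) = R.mv i * R.evM M := by simp [evM]

@[simp] lemma evM_append (M M' : List (R.Item × Bool)) :
    R.evM (M ++ M') = R.evM M * R.evM M' := by simp [evM]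

@[simp] lemma mcs_nil (s : Bool) : R.mcs s [] = 0 := rfl

@[simp] lemma mcs_cons (s : Bool) (i : R.Item × Bool) (M : List (R.Item × Bool)) :
    R.mcs s (i :: M) = R.mc s i + R.mcs s M := by simp [mcs]

@[simp] lemma mcs_append (s : Bool) (M M' : List (R.Item × Bool)) :
    R.mcs s (M ++ M') = R.mcs s M + R.mcs s M' := by simp [mcs]

@[simp] lemma mv_false (i : R.Item) : R.mv (i, false) = R.tv (tok i) := by
  obtain ⟨_ | _, _ | _⟩ := i <;> rfl

@[simp] lemma mv_some (x : H) (c : R.Corner) (b : Bool) :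
    R.mv ((some x, c), b) = R.ι x * R.ι (val c) := by
  obtain _ | _ := c <;> cases b <;> simp [mv, tok]

lemma mv_true (a : R.Λ) : R.mv ((none, .inl a), true) =
    (R.ρ a)⁻¹ * (R.T (R.δ a) * R.ι (R.g a)) := by
  simp [mv, tok, dir, val]

@[simp] lemma mc_false (s : Bool) (i : R.Item) : R.mc s (i, false) = 0 := by
  obtain ⟨_ | _, _ | _⟩ := i <;> rfl

@[simp] lemma mc_some (s : Bool) (x : H) (c : R.Corner) (b : Bool) :
    R.mc s ((some x, c), b) = 0 := by
  obtain _ | _ := c <;> cases b <;> rfl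

@[simp] lemma mc_true (s : Bool) (a : R.Λ) : R.mc s ((none, .inl a), true) =
    if R.sgn a = s then 1 else 0 := rfl

@[simp] lemma map_fst_unmarked (l : List R.Item) : (R.unmarked l).map Prod.fst = l := by
  simp [unmarked, Function.comp_def]

@[simp] lemma evM_unmarked (l : List R.Item) : R.evM (R.unmarked l) = R.evI l := by
  induction l with
  | nil => simp [unmarked]
  | cons i l ih =>
    simp only [unmarked, List.map_cons, evM_cons, mv_false, evI_cons] at ih ⊢
    rw [ih]

@[simp] lemma mcs_unmarked (s : Bool) (l : List R.Item) : R.mcs s (R.unmarked l) = 0 := by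
  induction l with
  | nil => simp [unmarked]
  | cons i l ih =>
    simp only [unmarked, List.map_cons, mcs_cons, mc_false, zero_add] at ih ⊢
    rw [ih]

/-- Marks in consecutive letters of a relator. -/
lemma evM_face (n : ℕ) (a : R.Λ) (M : List (R.Item × Bool)) (h : M.map Prod.fst = R.face a n) :
    ∃ m : ℕ, R.evM M = (R.ρ a)⁻¹ ^ m * R.evI (R.face a n) ∧ R.mcs (R.sgn a) M = m ∧
      R.mcs (!R.sgn a) M = 0 := by
  induction n generalizing a M with
  | zero =>
    obtain rfl : M = [] := by simpa [face] using h
    exact ⟨0, by simp [face]⟩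
  | succ n ih =>
    obtain ⟨⟨i, b⟩, M, rfl, rfl, h2⟩ := List.map_eq_cons_iff.1 h
    obtain ⟨m, h3, h4, h5⟩ := ih _ M h2
    rw [R.sgn_nxt] at h4 h5
    have key : R.T (R.δ a) * R.ι (R.g a) * (R.ρ (R.nxt a))⁻¹ ^ m =
        (R.ρ a)⁻¹ ^ m * (R.T (R.δ a) * R.ι (R.g a)) := by
      rw [ρ_nxt]
      set z := R.T (R.δ a) * R.ι (R.g a)
      rw [show (z⁻¹ * R.ρ a * z)⁻¹ = z⁻¹ * (R.ρ a)⁻¹ * z⁻¹⁻¹ by group, conj_pow]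
      group
    cases b
    · refine ⟨m, ?_, by simp [h4], by simp [h5]⟩
      simp only [evM_cons, mv_false, tok, tv_some, face, evI_cons, h3, dir, val]
      rw [← mul_assoc, key, mul_assoc]
    · refine ⟨m + 1, ?_, by simp [h4, add_comm], by simp [h5]⟩
      rw [evM_cons, mv_true, h3, mul_assoc, ← mul_assoc (R.T (R.δ a) * R.ι (R.g a)), key]
      simp only [face, evI_cons, tok, tv_some, dir, val, pow_succ']
      simp only [mul_assoc]

variable {R}

/-- The invariants of an annotated word made from `j` relators: `c₀` is the corner before the
word, `e` its original value and `C` a bound for its weight. -/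
structure Inv (c₀ : R.Corner) (e : F) (C : ℤ) (l : List R.Item) (j : ℕ) : Prop where
  valid : Valid c₀ l
  weight : swt c₀ l + (R.k - 2) * j ≤ letters (l.map tok) + C
  marks : ∀ M : List (R.Item × Bool), M.map Prod.fst = l → R.mcs true M ≤ 1 →
    R.mcs false M ≤ 1 → ∃ m, m + R.mcs true M + R.mcs false M ≤ j ∧ e⁻¹ * R.evM M ∈ R.N m

lemma Inv.evI_mem {c₀ : R.Corner} {e : F} {C : ℤ} {l : List R.Item} {j : ℕ}
    (h : Inv c₀ e C l j) : e⁻¹ * R.evI l ∈ R.N j := by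
  obtain ⟨m, h1, h2⟩ := h.marks (R.unmarked l) (by simp) (by simp) (by simp)
  rw [evM_unmarked] at h2
  exact N_mono (by omega) h2

/-- The effect of marking one letter. -/
lemma Inv.mark {c₀ : R.Corner} {e : F} {C : ℤ} {l : List R.Item} {j : ℕ}
    (h : Inv c₀ e C l j) {pre rest : List R.Item} {a : R.Λ}
    (hl : l = pre ++ (none, .inl a) :: rest) :
    ∃ m, m + 1 ≤ j ∧ e⁻¹ * (R.evI pre * ((R.ρ a)⁻¹ * (R.T (R.δ a) * R.ι (R.g a))) *
      R.evI rest) ∈ R.N m := by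
  obtain ⟨m, h1, h2⟩ := h.marks (R.unmarked pre ++ ((none, .inl a), true) :: R.unmarked rest)
    (by simp [hl]) (by simp; split <;> simp) (by simp; split <;> simp)
  refine ⟨m, ?_, ?_⟩
  · cases hs : R.sgn a <;> simpa [hs] using h1
  · simpa [mv_true, mul_assoc] using h2

lemma lw_add_lw {c c₁ d c₂ : R.Corner} (h1 : Step c (none, c₁)) (h2 : Step d (none, c₂))
    (x y : H) : lw c (some y, c₂) + lw d (some x, c₁) = 0 := by
  rcases c with a | a <;> rcases c₁ with a₁ | a₁ <;> rcases d with b | b <;>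
    rcases c₂ with b₁ | b₁ <;> simp only [Step] at h1 h2 <;> try simp [lw]
  subst h1 h2
  by_cases h : R.nxt b = R.inv (R.nxt a)
  · have h' : R.nxt a = R.inv (R.nxt b) := by rw [h, R.inv_inv]
    rw [if_pos h, if_pos h', h, R.ew_inv]; simp
  · have h' : R.nxt a ≠ R.inv (R.nxt b) := by
      intro h'; exact h (by rw [h', R.inv_inv])
    simp [h, h']

/-- Folding two consecutive mutually inverse letters around a closed vertex. -/
lemma Inv.fold {c₀ : R.Corner} {e : F} {C : ℤ} {l : List R.Item} {j : ℕ}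
    (h : Inv c₀ e C l j) {pre ys rest : List R.Item} {c₁ c₂ : R.Corner}
    (hl : l = pre ++ (none, c₁) :: (ys ++ (none, c₂) :: rest)) (hys : FlatI ys)
    (hdir : dir c₂ = !dir c₁) (hv : val c₁ * hp (ys.map tok) ∈ R.A (dir c₁))
    (hmin : ¬ ∃ m, m + 2 ≤ j ∧ e⁻¹ * R.evI l ∈ R.N m) :
    ∃ y, Inv c₀ e C (pre ++ (some y, c₂) :: rest) j ∧
      R.evI (pre ++ (some y, c₂) :: rest) = R.evI l := by
  have hev : R.evI ys = R.ι (hp (ys.map tok)) := by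
    rw [evI]
    refine Flat.ev_eq _ ?_
    intro i hi
    obtain ⟨⟨_ | x, c⟩, hi', rfl⟩ := List.mem_map.1 hi
    · exact absurd rfl (hys _ hi')
    · rfl
  have hletters : letters (ys.map tok) = 0 := by
    rw [letters_eq_zero]
    intro i hi
    obtain ⟨⟨_ | x, c⟩, hi', rfl⟩ := List.mem_map.1 hi
    · exact absurd rfl (hys _ hi')
    · rfl
  obtain ⟨y, hyA, hy⟩ := R.conj _ _ hv
  have hyT : R.ι y = R.T (dir c₁) * R.ι (val c₁ * hp (ys.map tok)) * (R.T (dir c₁))⁻¹ := by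
    rw [hy]; group
  have hmir : ∀ a, c₁ = .inl a → c₂ = .inl (R.inv a) → val c₁ * hp (ys.map tok) ≠ 1 := by
    rintro a rfl rfl hv1
    obtain ⟨m, h1, h2⟩ := h.marks (R.unmarked pre ++ ((none, .inl a), true) ::
      (R.unmarked ys ++ ((none, .inl (R.inv a)), true) :: R.unmarked rest)) (by simp [hl])
      (by cases hs : R.sgn a <;> simp [R.sgn_inv, hs])
      (by cases hs : R.sgn a <;> simp [R.sgn_inv, hs])
    refine hmin ⟨m, ?_, ?_⟩
    · cases hs : R.sgn a <;> simp [R.sgn_inv, hs] at h1 <;> omega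
    · convert h2 using 2
      rw [hl]
      have hv1' : R.ι (R.g a) * R.ι (hp (ys.map tok)) = 1 := by
        rw [← map_mul]; simpa [val] using congrArg R.ι hv1
      have hT := R.T_mul_ρ_inv' a
      simp only [evI_append, evI_cons, tok, tv_some, dir, val, hev, evM_append, evM_cons,
        evM_unmarked, mv_true, R.δ_inv, R.T_not]
      congr 1
      set z := R.ι (hp (ys.map tok))
      set u := R.ι (R.g (R.inv a)) * R.evI rest
      calc _ = R.T (R.δ a) * (R.ι (R.g a) * z) * (R.T (R.δ a))⁻¹ * u := by
            simp only [u, mul_assoc]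
        _ = (R.ρ a)⁻¹ * (R.T (R.δ a) * (R.ρ (R.inv a))⁻¹ * (R.T (R.δ a))⁻¹) * u := by
            rw [hv1', hT]; group
        _ = (R.ρ a)⁻¹ * (R.T (R.δ a) * ((R.ι (R.g a) * z) * (R.ρ (R.inv a))⁻¹ *
            (R.T (R.δ a))⁻¹)) * u := by rw [hv1']; group
        _ = _ := by simp only [u, mul_assoc]
  have hval := h.valid
  rw [hl, valid_append] at hval
  obtain ⟨hpre, hs1, hval⟩ := hval
  rw [valid_append] at hval
  obtain ⟨hvys, hs2, hrest⟩ := hval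
  simp only at hvys hs2 hrest
  set c := lastc c₀ pre with hc
  set d := lastc c₁ ys with hd
  have hclosed := two_le_swt_closed c₁ ys (val c₁ * hp (ys.map tok))⁻¹ hys (by
    rw [valid_append]
    refine ⟨hvys, ?_, trivial⟩
    rw [← hd]
    clear_value d
    rcases d with b | b <;> rcases c₁ with a | a <;> rcases c₂ with a₂ | a₂ <;>
      simp only [Step] at hs2 <;> try trivial
    subst hs2
    refine ⟨?_, inv_mem hv, ?_⟩
    · simp only [dir] at hdir
      rw [hdir, Bool.not_not]
    · rintro rfl
      exact inv_ne_one.2 (hmir _ rfl (by rw [R.inv_inv]))) (by simp)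
  rw [swt_append, ← hd] at hclosed
  have hlw := lw_add_lw hs1 hs2 (val c₁ * hp (ys.map tok))⁻¹ y
  refine ⟨y, ⟨?_, ?_, ?_⟩, ?_⟩
  · rw [valid_append]
    refine ⟨hpre, ?_, hrest⟩
    rw [← hc]
    clear_value c
    rcases c with b | b <;> rcases c₁ with a | a <;> rcases c₂ with a₂ | a₂ <;>
      simp only [Step] at hs1 <;> try trivial
    subst hs1
    simp only [dir] at hdir
    refine ⟨hdir, by simpa [hdir, dir] using hyA, ?_⟩
    rintro rfl rfl
    refine hmir _ rfl rfl (R.ι_inj ?_)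
    rw [map_one] at hyT ⊢
    calc _ = (R.T (R.δ (R.nxt b)))⁻¹ * 1 * R.T (R.δ (R.nxt b)) := by
          rw [hyT]; simp only [dir]; group
      _ = 1 := by group
  · have hw := h.weight
    rw [hl] at hw
    simp only [swt_append, swt, List.map_append, List.map_cons, tok, letters_append, letters_some,
      letters_none, hletters, ← hc, ← hd] at hw hclosed ⊢
    have l1 : lw c (none, c₁) = 0 := by rcases c with _ | _ <;> rfl
    have l2 : lw d (none, c₂) = 0 := by rcases d with _ | _ <;> rfl
    push_cast at hw ⊢
    rw [l1, l2] at hw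
    linarith
  · intro M hM hM1 hM2
    obtain ⟨P, Q, rfl, rfl, hQ⟩ := List.map_eq_append_iff.1 hM
    obtain ⟨⟨i, b⟩, Q, rfl, rfl, rfl⟩ := List.map_eq_cons_iff.1 hQ
    obtain ⟨m, h1, h2⟩ := h.marks (P ++ ((none, c₁), false) ::
      (R.unmarked ys ++ ((none, c₂), false) :: Q)) (by simp [hl]) (by simpa using hM1)
      (by simpa using hM2)
    refine ⟨m, by simpa using h1, ?_⟩
    convert h2 using 2
    simp only [evM_append, evM_cons, mv_some, hyT, mv_false, evM_unmarked, hev, tok, tv_some,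
      hdir, R.T_not, map_mul, mul_assoc]
  · simp only [hl, evI_append, evI_cons, tok, tv_none, tv_some, hev, hdir, R.T_not, map_mul, hyT,
      mul_assoc]

end Relator
end RelIso

/-! ### Attaching relators -/

namespace RelIso
namespace Relator

open HNNData

variable {H F : Type*} [Group H] [Group F] {R : Relator H F}

lemma lastc_face (a : R.Λ) (n : ℕ) :
    lastc (.inl a) (R.face (R.nxt a) n) = .inl (R.nxt^[n] a) := by
  induction n generalizing a with
  | zero => rfl
  | succ n ih => simp [face, lastc, ih]

lemma valid_face (a : R.Λ) (n : ℕ) : Valid (.inl a) (R.face (R.nxt a) n) := by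
  induction n generalizing a with
  | zero => trivial
  | succ n ih => exact ⟨rfl, ih _⟩

lemma swt_face (a : R.Λ) (n : ℕ) : swt (.inl a) (R.face (R.nxt a) n) =
    ∑ i ∈ Finset.range n, cw (.inl (R.nxt^[i] a) : R.Corner) := by
  induction n generalizing a with
  | zero => rfl
  | succ n ih =>
    rw [Finset.sum_range_succ', face, swt, ih]
    simp [lw, add_comm]

lemma letters_face (a : R.Λ) (n : ℕ) : letters ((R.face a n).map tok) = n := by
  induction n generalizing a with
  | zero => rfl
  | succ n ih => simp [face, tok, ih]

lemma sum_cw_le (a : R.Λ) :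
    ∑ i ∈ Finset.range R.K, cw (.inl (R.nxt^[i] a) : R.Corner) ≤ R.K - R.k := by
  have h := R.k_le a
  have h2 : ∑ i ∈ Finset.range R.K, cw (.inl (R.nxt^[i] a) : R.Corner) =
      R.K - ((∑ i ∈ Finset.range R.K, if R.isC (R.nxt^[i] a) then 1 else 0 : ℕ) : ℤ) := by
    push_cast
    rw [eq_sub_iff_add_eq, ← Finset.sum_add_distrib]
    simp only [cw]
    rw [Finset.sum_congr rfl (g := fun _ => (1 : ℤ))]
    · simp
    · intro i _; split_ifs <;> simp
  rw [h2]
  have : (R.k : ℤ) ≤ ((∑ i ∈ Finset.range R.K, if R.isC (R.nxt^[i] a) then 1 else 0 : ℕ) : ℤ) := by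
    exact_mod_cast h
  linarith

/-- Attaching a relator to a letter. -/
lemma Inv.attach {c₀ : R.Corner} {e : F} {C : ℤ} {l : List R.Item} {j : ℕ}
    (h : Inv c₀ e C l j) {pre rest : List R.Item} {c₁ : R.Corner}
    (hl : l = pre ++ (none, c₁) :: rest) {a : R.Λ} (ha : R.δ a = !dir c₁) {q : H}
    (hq : q ∈ R.A (R.δ a))
    (hmin : ¬ ∃ m, m + 2 ≤ j + 1 ∧ e⁻¹ * (R.evI pre * ((R.ι q * R.T (dir c₁)) * R.ρ a *
      (R.ι q * R.T (dir c₁))⁻¹) * (R.T (dir c₁) * R.ι (val c₁) * R.evI rest)) ∈ R.N m) :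
    ∃ q', Inv c₀ e C
      (pre ++ (some q, .inl a) :: (R.face (R.nxt a) (R.K - 1) ++ (some q', c₁) :: rest)) (j + 1) ∧
      R.evI (pre ++ (some q, .inl a) :: (R.face (R.nxt a) (R.K - 1) ++ (some q', c₁) :: rest)) =
        R.evI pre * ((R.ι q * R.T (dir c₁)) * R.ρ a *
      (R.ι q * R.T (dir c₁))⁻¹) * (R.T (dir c₁) * R.ι (val c₁) * R.evI rest) := by
  obtain ⟨y, hyA, hy⟩ := R.conj _ _ hq
  obtain ⟨K', hK⟩ : ∃ K', R.K = K' + 1 := ⟨R.K - 1, (Nat.sub_add_cancel R.K_pos).symm⟩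
  have hK' : R.K - 1 = K' := by omega
  rw [hK']
  have hT : R.T (R.δ a) = (R.T (dir c₁))⁻¹ := by rw [ha, R.T_not]
  set τ := R.T (dir c₁) with hτ
  have hyT : R.ι y⁻¹ = τ⁻¹ * (R.ι q)⁻¹ * τ := by
    rw [map_inv, inv_eq_iff_eq_inv, ← mul_right_cancel_iff (a := τ⁻¹), ← hT, ← hy, hT]; group
  have hρ : R.ρ a = τ⁻¹ * R.ι (R.g a) * R.evI (R.face (R.nxt a) K') := by
    rw [ρ, hK, face, evI_cons, tok, tv_some, dir, val, hT]
  have hmir : ∀ b, c₁ = .inl b → a = R.inv b → q ≠ 1 := by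
    rintro b rfl rfl rfl
    obtain ⟨m, h1, h2⟩ := h.mark hl
    refine hmin ⟨m, by omega, ?_⟩
    convert h2 using 2
    rw [← R.T_mul_ρ_inv b]
    simp only [hτ, map_one, one_mul, mul_assoc, dir, val]
  have hval := h.valid
  rw [hl, valid_append] at hval
  obtain ⟨hpre, hs1, hrest⟩ := hval
  simp only at hrest
  have hz : R.nxt (R.nxt^[K'] a) = a := by
    rw [← Function.iterate_succ_apply' R.nxt, Nat.succ_eq_add_one, ← hK, R.nxt_K]
  have hs2 : Step (.inl (R.nxt^[K'] a) : R.Corner) (none, .inl a) := hz.symm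
  refine ⟨y⁻¹, ⟨?_, ?_, ?_⟩, ?_⟩
  · rw [valid_append]
    refine ⟨hpre, ?_, ?_⟩
    · generalize lastc c₀ pre = c at *
      rcases c with b | b <;> rcases c₁ with b' | b' <;> simp only [Step] at hs1 <;> try trivial
      subst hs1
      exact ⟨ha, hq, fun h => hmir _ rfl h⟩
    · rw [valid_append]
      refine ⟨valid_face _ _, ?_, hrest⟩
      rw [lastc_face]
      rcases c₁ with b | b
      swap
      · trivial
      refine ⟨?_, ?_, ?_⟩
      · rw [hz, ha]; simp [dir]
      · refine inv_mem ?_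
        simpa [ha, dir] using hyA
      · rintro h1 h2
        rw [hz] at h1
        refine hmir b rfl (by rw [h1, R.inv_inv]) (R.ι_inj ?_)
        rw [h2, map_one] at hyT
        rw [map_one, ← inv_inj, inv_one]
        calc _ = τ * (τ⁻¹ * (R.ι q)⁻¹ * τ) * τ⁻¹ := by group
          _ = 1 := by rw [← hyT]; group
  · have hw := h.weight
    have hsum := sum_cw_le a
    rw [hK, Finset.sum_range_succ] at hsum
    have hlw := lw_add_lw hs1 hs2 y⁻¹ q
    rw [hl] at hw
    have l1 : lw (lastc c₀ pre) (none, c₁) = 0 := by rcases lastc c₀ pre with _ | _ <;> rfl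
    simp only [swt_append, swt, List.map_append, List.map_cons, tok, letters_append, letters_some,
      letters_none, lastc_face, swt_face, letters_face, l1] at hw ⊢
    push_cast at hw hsum ⊢
    linarith
  · intro M hM hM1 hM2
    obtain ⟨P, Q, rfl, rfl, hQ⟩ := List.map_eq_append_iff.1 hM
    obtain ⟨⟨i, b⟩, Q, rfl, rfl, hQ'⟩ := List.map_eq_cons_iff.1 hQ
    obtain ⟨Q, S, rfl, hQf, hS⟩ := List.map_eq_append_iff.1 hQ'
    obtain ⟨⟨i, b'⟩, S, rfl, rfl, rfl⟩ := List.map_eq_cons_iff.1 hS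
    obtain ⟨n, hn, hn1, hn2⟩ := evM_face _ _ _ _ hQf
    rw [R.sgn_nxt] at hn1 hn2
    simp only [mcs_append, mcs_cons, mc_some] at hM1 hM2
    obtain ⟨m, h1, h2⟩ := h.marks (P ++ ((none, c₁), false) :: S) (by simp [hl])
      (by simp; omega) (by simp; omega)
    simp only [mcs_append, mcs_cons, mc_some, mc_false, zero_add] at h1 ⊢
    have hn' : n = 0 ∨ n = 1 := by
      cases hs : R.sgn a <;> rw [hs] at hn1 <;> omega
    rcases hn' with rfl | rfl
    · refine ⟨1 + m, ?_, ?_⟩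
      · cases hs : R.sgn a <;> simp only [hs, Bool.not_true, Bool.not_false] at hn1 hn2 <;> omega
      · have := N_mul (N_conj (ρ_mem_N a) (e⁻¹ * R.evM P * R.ι q * τ)) h2
        convert this using 1
        simp only [evM_append, evM_cons, mv_some, hyT, hn, mv_false, tok, tv_some, ← hτ, hρ,
          show val (.inl a : R.Corner) = R.g a from rfl]
        group
    · refine ⟨m, ?_, ?_⟩
      · cases hs : R.sgn a <;> simp only [hs, Bool.not_true, Bool.not_false] at hn1 hn2 <;> omega
      · convert h2 using 2
        simp only [evM_append, evM_cons, mv_some, hyT, hn, mv_false, tok, tv_some, ← hτ, ρ_nxt,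
          hT, hρ, show val (.inl a : R.Corner) = R.g a from rfl]
        group
  · simp only [evI_append, evI_cons, tok, tv_none, val, hyT, hρ, map_mul]
    group

end Relator
end RelIso

/-! ### Peeling off relators -/

namespace RelIso
namespace Relator

open HNNData

variable {H F : Type*} [Group H] [Group F] {R : Relator H F}

lemma map_tok_eq_append {l : List R.Item} {a b : List (Tok H)} {e : Bool} {h : H}
    (hl : l.map tok = a ++ (some e, h) :: b) : ∃ pre c rest, l = pre ++ (none, c) :: rest ∧
      pre.map tok = a ∧ rest.map tok = b ∧ dir c = e ∧ val c = h := by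
  obtain ⟨pre, q, rfl, rfl, hq⟩ := List.map_eq_append_iff.1 hl
  obtain ⟨⟨_ | x, c⟩, rest, rfl, hc, rfl⟩ := List.map_eq_cons_iff.1 hq
  · simp only [tok, Prod.mk.injEq, Option.some.injEq] at hc
    exact ⟨pre, c, rest, rfl, rfl, rfl, hc⟩
  · simp [tok] at hc

lemma append_eq_append_cons {α : Type*} {u w l₁ l₂ : List α} {i : α}
    (h : u ++ w = l₁ ++ i :: l₂) :
    (∃ p, u = l₁ ++ i :: p ∧ l₂ = p ++ w) ∨ ∃ p, l₁ = u ++ p ∧ w = p ++ i :: l₂ := by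
  rcases List.append_eq_append_iff.1 h with ⟨p, rfl, h2⟩ | ⟨_ | ⟨a, p⟩, rfl, h2⟩
  · exact Or.inr ⟨p, rfl, h2⟩
  · exact Or.inr ⟨[], by simp, h2.symm⟩
  · obtain ⟨rfl, rfl⟩ := List.cons_eq_cons.1 h2
    exact Or.inl ⟨p, rfl, rfl⟩

lemma flatI_of_flat {l : List R.Item} (h : Flat (l.map tok)) : FlatI l := by
  rintro ⟨_ | x, c⟩ hi
  · simpa [tok] using h _ (List.mem_map_of_mem hi)
  · simp

lemma evI_of_flat {l : List R.Item} (h : Flat (l.map tok)) :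
    R.evI l = R.ι (hp (l.map tok)) := h.ev_eq _

variable (R) in
/-- Inserting a conjugate of the relator at the letter between two words leads to area at most
`n`. -/
def Peels (n : ℕ) (l₁ : List (Tok H)) (e : Bool) (h : H) (l₂ : List (Tok H)) : Prop :=
  ∃ a, R.δ a = !e ∧ ∃ q ∈ R.A (!e), R.ev l₁ * ((R.ι q * R.T e) * R.ρ a * (R.ι q * R.T e)⁻¹) *
    (R.T e * R.ι h * R.ev l₂) ∈ R.N n

variable (R) in
/-- Inserting a conjugate of the relator at some letter of a word leads to area at most `n`. -/
def Peelable (n : ℕ) (l : List (Tok H)) : Prop :=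
  ∃ l₁ e h l₂, l = l₁ ++ (some e, h) :: l₂ ∧ R.Peels n l₁ e h l₂

variable (R) in
/-- The area of an element. -/
def Area (f : F) (n : ℕ) : Prop := f ∈ R.N n ∧ ∀ m, f ∈ R.N m → n ≤ m

/-- All corners of an annotated word come from relators. -/
def Faces (l : List R.Item) : Prop := ∀ i ∈ l, IsFace i.2

lemma faces_append {l m : List R.Item} : Faces (l ++ m) ↔ Faces l ∧ Faces m := by
  simp only [Faces, List.mem_append]
  constructor
  · exact fun h => ⟨fun i hi => h i (Or.inl hi), fun i hi => h i (Or.inr hi)⟩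
  · rintro ⟨h1, h2⟩ i (hi | hi)
    exacts [h1 i hi, h2 i hi]

lemma faces_cons {i : R.Item} {l : List R.Item} : Faces (i :: l) ↔ IsFace i.2 ∧ Faces l := by
  simp [Faces]

lemma faces_face (a : R.Λ) (n : ℕ) : Faces (R.face a n) := by
  induction n generalizing a with
  | zero => simp [Faces, face]
  | succ n ih => exact faces_cons.2 ⟨rfl, ih _⟩

/-- A step of the reduction of an annotated word between two fixed words. -/
lemma Inv.step {c₀ : R.Corner} {e : F} {C : ℤ} {l : List R.Item} {j d : ℕ} (h : Inv c₀ e C l j)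
    {u v : List (Tok H)} (hn : ∀ m, R.ev u * e * R.ev v ∈ R.N m → j + d ≤ m)
    (hY : R.ev u * R.evI l * R.ev v ∈ R.N d) (hl : ¬ Flat (l.map tok))
    (IH : ∀ z, ¬ R.Pinch z → R.Area (R.ev z) d → 0 < d → R.Peelable (d - 1) z) :
    (∃ l', Inv c₀ e C l' j ∧ letters (l'.map tok) < letters (l.map tok) ∧ R.evI l' = R.evI l ∧
      (Faces l → Faces l')) ∨
    (∃ l' d', d = d' + 1 ∧ Inv c₀ e C l' (j + 1) ∧ R.ev u * R.evI l' * R.ev v ∈ R.N d' ∧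
      (Faces l → Faces l')) ∨
    (R.Pinch (u ++ l.map tok) ∧ ¬ R.Pinch (l.map tok)) ∨
    (R.Pinch (l.map tok ++ v) ∧ ¬ R.Pinch (l.map tok)) ∨
    ∃ d', d = d' + 1 ∧ ∃ l₁ e h l₂, (u = l₁ ++ (some e, h) :: l₂ ∧
      R.Peels d' l₁ e h (l₂ ++ (l.map tok ++ v)) ∨
      v = l₁ ++ (some e, h) :: l₂ ∧ R.Peels d' (u ++ (l.map tok ++ l₁)) e h l₂) := by
  have hmin : ∀ l', ∀ m d', d' ≤ d → R.ev u * R.evI l' * R.ev v ∈ R.N d' →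
      e⁻¹ * R.evI l' ∈ R.N m → j + d ≤ d' + m := by
    intro l' m d' hd' h1 h2
    refine hn _ ?_
    convert N_mul h1 (N_conj' (N_inv h2) (R.ev v)) using 1
    group
  by_cases hP : R.Pinch (l.map tok)
  · left
    obtain ⟨a, s, x, ys, x', b, h1, h2, h3⟩ := hP
    obtain ⟨pre, c₁, rest, rfl, rfl, h4, rfl, rfl⟩ := map_tok_eq_append h1
    obtain ⟨ys, c₂, rest, rfl, rfl, rfl, hc, rfl⟩ := map_tok_eq_append h4
    obtain ⟨y, h5, h6⟩ := h.fold rfl (flatI_of_flat h2) hc h3 (by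
      rintro ⟨m, hm1, hm2⟩
      have := hmin _ m d le_rfl hY hm2
      omega)
    refine ⟨_, h5, ?_, h6, ?_⟩
    · simp [tok]; omega
    · simp only [faces_append, faces_cons]
      tauto
  right
  by_cases hP2 : R.Pinch (u ++ (l.map tok ++ v))
  · rcases hP2.of_append_append hl with h1 | h1
    · exact Or.inr (Or.inl ⟨h1, hP⟩)
    · exact Or.inr (Or.inr (Or.inl ⟨h1, hP⟩))
  have hev : R.ev (u ++ (l.map tok ++ v)) = R.ev u * R.evI l * R.ev v := by
    simp [evI, mul_assoc]
  rcases d with _ | d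
  · rw [mem_N_zero, ← hev] at hY
    have := R.flat_of_ev_eq_one hP2 hY
    simp only [flat_append] at this
    exact absurd this.2.1 hl
  obtain ⟨l₁, s, x, l₂, h1, h2⟩ := IH _ hP2 (by
    rw [hev]
    refine ⟨hY, fun m hm => ?_⟩
    have := hn (m + j) (by
      convert N_mul hm (N_conj' (N_inv h.evI_mem) (R.ev v)) using 1
      group)
    omega) (by omega)
  rw [Nat.add_sub_cancel] at h2
  rcases append_eq_append_cons h1 with ⟨p, rfl, rfl⟩ | ⟨p, rfl, h3⟩
  · exact Or.inr (Or.inr (Or.inr ⟨d, rfl, l₁, s, x, p, Or.inl ⟨rfl, h2⟩⟩))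
  rcases append_eq_append_cons h3 with ⟨q, h4, rfl⟩ | ⟨q, rfl, h4⟩
  · obtain ⟨pre, c₁, rest, rfl, rfl, rfl, rfl, rfl⟩ := map_tok_eq_append h4
    obtain ⟨a, h6, q, hq, h7⟩ := h2
    have h8 : R.ev u * (R.evI pre * ((R.ι q * R.T (dir c₁)) * R.ρ a *
        (R.ι q * R.T (dir c₁))⁻¹) * (R.T (dir c₁) * R.ι (val c₁) * R.evI rest)) *
        R.ev v ∈ R.N d := by
      convert h7 using 1
      simp only [ev_append, evI, mul_assoc]
    obtain ⟨q', h9, h10⟩ := h.attach rfl h6 (by rwa [h6]) (by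
      rintro ⟨m, hm1, hm2⟩
      have := hn (d + m) (by
        convert N_mul h8 (N_conj' (N_inv hm2) (R.ev v)) using 1
        group)
      omega)
    refine Or.inl ⟨_, d, rfl, h9, by rwa [h10], ?_⟩
    simp only [faces_append, faces_cons]
    have := faces_face (R.nxt a) (R.K - 1)
    have : IsFace (.inl a : R.Corner) := rfl
    tauto
  · exact Or.inr (Or.inr (Or.inr ⟨d, rfl, q, s, x, l₂, Or.inr ⟨h4, h2⟩⟩))

end Relator
end RelIso

namespace RelIso
namespace Relator

open HNNData
open scoped Pointwise

variable {H F : Type*} [Group H] [Group F] {R : Relator H F}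

lemma Peelable.transfer {n : ℕ} {z z' : List (Tok H)} (h : R.Peelable n z) (hz : ¬ R.Pinch z)
    (hz' : ¬ R.Pinch z') (hev : R.ev z = R.ev z') : R.Peelable n z' := by
  obtain ⟨l₁, e, h, l₂, rfl, a, ha, q, hq, hN⟩ := h
  obtain ⟨a', h', b', rfl, x, hx, h2⟩ := R.toHNNPres.transfer _ _ z' le_rfl hz hz' hev _ _ _ _ rfl
  refine ⟨a', e, h', b', rfl, a, ha, x * q, mul_mem hx hq, ?_⟩
  have h3 : R.T e * R.ι h' * R.ev b' = R.ι x * (R.T e * R.ι h * R.ev l₂) := by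
    simp only [ev_append, ev_cons, tv_some, h2] at hev
    have := congrArg (fun f => (R.ev a')⁻¹ * f) hev
    simp only [mul_assoc, inv_mul_cancel_left] at this ⊢
    exact this.symm
  rw [h3]
  convert hN using 1
  rw [h2, map_mul]
  group

variable (R) in
/-- Inserting the relator between two words leads to area at most `n`. -/
def Pair (f : F) (n : ℕ) (u v : List (Tok H)) : Prop :=
  R.ev u * R.ev v = f ∧ ∃ a, R.ev u * R.ρ a * R.ev v ∈ R.N n

variable (R) in
/-- Pairs of words with a minimal number of letters such that inserting the relator between them
leads to area at most `n`. -/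
def MinPair (f : F) (n : ℕ) (u v : List (Tok H)) : Prop :=
  R.Pair f n u v ∧ ∀ u' v', R.Pair f n u' v' → letters u + letters v ≤ letters u' + letters v'

lemma Pair.mk_conj {f : F} {n : ℕ} {u v : List (Tok H)} (h1 : R.ev u * R.ev v = f) (x : H) (a : R.Λ)
    (h2 : R.ev u * (R.ι x * R.ρ a * (R.ι x)⁻¹) * R.ev v ∈ R.N n) :
    R.Pair f n (u ++ [(none, x)]) ((none, x⁻¹) :: v) := by
  refine ⟨by simpa [mul_assoc] using h1, a, ?_⟩
  simpa [mul_assoc] using h2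

lemma MinPair.not_pinch_left {f : F} {n : ℕ} {u v : List (Tok H)} (h : R.MinPair f n u v) :
    ¬ R.Pinch u := by
  intro hP
  obtain ⟨u', h1, h2⟩ := hP.exists_shorter
  have := h.2 u' v (by simpa [Pair, h1] using h.1)
  omega

lemma MinPair.not_pinch_right {f : F} {n : ℕ} {u v : List (Tok H)} (h : R.MinPair f n u v) :
    ¬ R.Pinch v := by
  intro hP
  obtain ⟨v', h1, h2⟩ := hP.exists_shorter
  have := h.2 u v' (by simpa [Pair, h1] using h.1)
  omega

lemma MinPair.not_pinch_of_peelable {f : F} {n : ℕ} {u v : List (Tok H)} (h : R.MinPair f n u v)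
    (hP : R.Peelable n (u ++ v)) : ¬ R.Pinch (u ++ v) := by
  obtain ⟨l₁, e, x, l₂, h1, a, ha, q, hq, hN⟩ := hP
  have hlet : letters u + letters v = letters l₁ + 1 + letters l₂ := by
    rw [← letters_append, h1]; simp; omega
  have hev : R.ev l₁ * (R.T e * R.ι x * R.ev l₂) = f := by
    rw [← h.1.1, ← ev_append, h1]; simp [mul_assoc]
  have hTa : R.T (R.δ a) = (R.T e)⁻¹ := by rw [ha, R.T_not]
  obtain ⟨y, -, hy⟩ := R.conj _ _ hq
  have p1 := Pair.mk_conj (u := l₁) (v := (some e, x) :: l₂) (f := f) (n := n) (by simpa using hev)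
    (q * R.g a) (R.nxt a) (by
      convert hN using 1
      simp only [ev_cons, tv_some, map_mul, ρ_nxt, hTa]
      group)
  have p2 := Pair.mk_conj (u := l₁ ++ [(some e, x)]) (v := l₂) (f := f) (n := n)
    (by simpa [mul_assoc] using hev) (x⁻¹ * y) a (by
      convert hN using 1
      have : R.ι y = (R.T e)⁻¹ * R.ι q * R.T e := by
        rw [R.T_not] at hy; rw [hy]; group
      simp only [ev_cons, tv_some, map_mul, map_inv, this, ev_append, ev_nil]
      group)
  have m1 : R.MinPair f n _ _ := ⟨p1, fun u' v' h' => by have := h.2 u' v' h'; simp; omega⟩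
  have m2 : R.MinPair f n _ _ := ⟨p2, fun u' v' h' => by have := h.2 u' v' h'; simp; omega⟩
  intro hP
  rw [h1, ← List.singleton_append] at hP
  rcases hP.of_append_append (by simp [Flat]) with h2 | h2
  · exact m2.not_pinch_left (h2.append_right _)
  · exact m1.not_pinch_right (h2.append_left [(none, (q * R.g a)⁻¹)])

/-- The reduction of an annotated word between the two words of a minimal pair. -/
lemma Inv.run (hk : 2 ≤ R.k) {f : F} {n : ℕ} (hf : R.Area f (n + 1)) {u v : List (Tok H)}
    (huv : R.MinPair f n u v) {c₀ : R.Corner}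
    (IH : ∀ d ≤ n, ∀ z, ¬ R.Pinch z → R.Area (R.ev z) d → 0 < d → R.Peelable (d - 1) z) :
    ∀ d r : ℕ, ∀ (l : List R.Item) (j : ℕ), Inv c₀ 1 (-2) l j → Faces l → j + d = n + 1 → 1 ≤ j →
      R.ev u * R.evI l * R.ev v ∈ R.N d → letters (l.map tok) = r → R.Peelable n (u ++ v) := by
  intro d
  induction d using Nat.strong_induction_on with | _ d ihd
  intro r
  induction r using Nat.strong_induction_on with | _ r ihr
  rintro l j h hl hj hj1 hY rfl
  have hflat : ¬ Flat (l.map tok) := by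
    intro hfl
    rw [← letters_eq_zero] at hfl
    have h1 := h.weight
    have h2 := swt_nonneg h.valid
    have h3 : (0 : ℤ) ≤ (R.k - 2) * j := mul_nonneg (by omega) (by omega)
    rw [hfl] at h1
    omega
  have huv1 : R.ev u * 1 * R.ev v = f := by rw [mul_one, huv.1.1]
  rcases h.step (u := u) (v := v) (d := d) (fun m hm => by
    rw [huv1] at hm
    exact hj ▸ hf.2 m hm) hY hflat (IH d (by omega)) with
    ⟨l', h1, h2, h3, h4⟩ | ⟨l', d', rfl, h1, h2, h3⟩ | ⟨h1, h2⟩ | ⟨h1, h2⟩ |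
    ⟨d', rfl, l₁, e, x, l₂, ⟨rfl, a, ha, q, hq, h2⟩ | ⟨rfl, a, ha, q, hq, h2⟩⟩
  · exact ihr _ h2 l' j h1 (h4 hl) hj hj1 (by rwa [h3]) rfl
  · exact ihd d' (by omega) _ l' (j + 1) h1 (h3 hl) (by omega) (by omega) h2 rfl
  · rcases h1.of_append with h1 | h1 | ⟨a, e, x, ys, zs, x', b, rfl, h3, h4, h5, h6⟩
    · exact absurd h1 huv.not_pinch_left
    · exact absurd h1 h2
    obtain ⟨pre, c₁, rest, rfl, rfl, rfl, hc, rfl⟩ := map_tok_eq_append h3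
    rcases c₁ with a₁ | a₁
    swap
    · simpa [IsFace] using hl (none, .inr a₁) (by simp)
    obtain ⟨m, hm, hN⟩ := h.mark rfl
    obtain ⟨q, hq, hqT⟩ := R.conj _ _ h6
    refine ⟨a, e, x, ys ++ v, by simp, a₁, hc, q, hq, ?_⟩
    refine N_mono (show d + m ≤ n by omega) ?_
    convert N_mul hY (N_conj' (N_inv hN) (R.ev v)) using 1
    have hq' : R.ι q * R.T e = R.T e * R.ι x * R.ev ys * R.evI pre := by
      rw [← hqT, evI_of_flat h5, h4.ev_eq]; simp only [map_mul, mul_assoc]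
    simp only [hq', ev_append, ev_cons, tv_some, evI_append, evI_cons, tok, dir, val]
    group
  · rcases h1.of_append with h1 | h1 | ⟨a, e, x, ys, zs, x', b, h3, rfl, h4, h5, h6⟩
    · exact absurd h1 h2
    · exact absurd h1 huv.not_pinch_right
    obtain ⟨pre, c₁, rest, rfl, rfl, rfl, hc, rfl⟩ := map_tok_eq_append h3
    rcases c₁ with a₁ | a₁
    swap
    · simpa [IsFace] using hl (none, .inr a₁) (by simp)
    obtain ⟨m, hm, hN⟩ := h.mark rfl
    have hc' : R.δ a₁ = e := hc
    subst hc'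
    refine ⟨u ++ zs, !R.δ a₁, x', b, by simp, a₁, by simp,
      (val (.inl a₁ : R.Corner) * hp (rest.map tok) * hp zs)⁻¹, by
        simpa only [Bool.not_not] using inv_mem h6, ?_⟩
    refine N_mono (show d + m ≤ n by omega) ?_
    convert N_mul (N_conj (N_inv hN) (R.ev u)) hY using 1
    · rw [add_comm]
    simp only [ev_append, evI_append, evI_cons, tok, dir, val, map_mul, map_inv, evI_of_flat h4,
      h5.ev_eq, ev_cons, tv_some, R.T_not]
    group
  · refine ⟨l₁, e, x, l₂ ++ v, by simp, a, ha, q, hq, ?_⟩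
    refine N_mono (show d' + j ≤ n by omega) ?_
    convert N_mul h2 (N_conj' (N_inv h.evI_mem) (R.ev v)) using 1
    simp only [ev_append, evI]
    group
  · refine ⟨u ++ l₁, e, x, l₂, by simp, a, ha, q, hq, ?_⟩
    refine N_mono (show j + d' ≤ n by omega) ?_
    convert N_mul (N_conj (N_inv h.evI_mem) (R.ev u)) h2 using 1
    simp only [ev_append, evI]
    group

/-- A relator can be attached to any reduced word of positive area. -/
theorem peelable (hk : 2 ≤ R.k) (n : ℕ) : ∀ z, ¬ R.Pinch z → R.Area (R.ev z) n → 0 < n →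
    R.Peelable (n - 1) z := by
  induction n using Nat.strong_induction_on with | _ n ih
  intro z hz hA hn
  obtain ⟨n, rfl⟩ : ∃ m, n = m + 1 := ⟨n - 1, by omega⟩
  rw [Nat.add_sub_cancel]
  obtain ⟨u, v, huv⟩ : ∃ u v, R.MinPair (R.ev z) n u v := by
    have hne : {p : List (Tok H) × List (Tok H) | R.Pair (R.ev z) n p.1 p.2}.Nonempty := by
      have h1 := hA.1
      rw [N, pow_succ'] at h1
      obtain ⟨f, hf, g, hg, hfg⟩ := h1
      simp only at hfg
      replace hg : g ∈ R.N n := hg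
      rcases hf with rfl | ⟨x, a, rfl⟩
      · rw [one_mul] at hfg
        have := hA.2 n (by rwa [← hfg])
        omega
      · obtain ⟨u, hu⟩ := R.gen (x * R.T (R.δ a))
        obtain ⟨v, hv⟩ := R.gen ((x * R.T (R.δ a))⁻¹ * R.ev z)
        refine ⟨(u, v), by rw [hu, hv]; group, R.inv a, ?_⟩
        convert hg using 1
        rw [hu, hv, ← hfg]
        calc _ = x * (R.T (R.δ a) * R.ρ (R.inv a) * (R.T (R.δ a))⁻¹) * R.ρ a * x⁻¹ * g := by group
          _ = g := by rw [T_mul_ρ_inv]; group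
    obtain ⟨p, hp, hmin⟩ := (measure fun p : List (Tok H) × List (Tok H) =>
      letters p.1 + letters p.2).wf.has_min _ hne
    exact ⟨p.1, p.2, hp, fun u' v' h' => not_lt.1 (hmin (u', v') h')⟩
  obtain ⟨-, a, ha⟩ := huv.1
  obtain ⟨b, rfl⟩ : ∃ b, R.nxt b = a := by
    obtain ⟨K', hK⟩ : ∃ K', R.K = K' + 1 := ⟨R.K - 1, (Nat.sub_add_cancel R.K_pos).symm⟩
    exact ⟨R.nxt^[K'] a, by rw [← Function.iterate_succ_apply' R.nxt, Nat.succ_eq_add_one, ← hK,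
      R.nxt_K]⟩
  have hP := Inv.run hk hA huv (c₀ := .inl b) (fun d hd => ih d (by omega)) n _
    (R.face (R.nxt b) R.K) 1 ⟨valid_face _ _, ?_, ?_⟩ (faces_face _ _) (by omega) le_rfl ha rfl
  · exact hP.transfer (huv.not_pinch_of_peelable hP) hz (by rw [ev_append, huv.1.1])
  · have := sum_cw_le b
    rw [swt_face, letters_face]
    push_cast
    linarith
  · intro M hM hM1 hM2
    obtain ⟨m, h1, h2, h3⟩ := R.evM_face _ _ _ hM
    rw [R.sgn_nxt] at h2 h3
    refine ⟨1 - m, ?_, ?_⟩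
    · cases hs : R.sgn b <;> simp only [hs, Bool.not_true, Bool.not_false] at h2 h3 <;> omega
    · have : m = 0 ∨ m = 1 := by
        cases hs : R.sgn b <;> simp only [hs] at h2 <;> omega
      rw [h1]
      rcases this with rfl | rfl
      · simpa [ρ] using ρ_mem_N (R.nxt b)
      · exact mem_N_zero.2 (by simp [ρ])

end Relator
end RelIso

/-! ### The isoperimetric inequality for words -/

namespace RelIso
namespace Relator

open HNNData

variable {H F : Type*} [Group H] [Group F] {R : Relator H F}

lemma not_flat_of_some {a b : List (Tok H)} {e : Bool} {h : H} :
    ¬ Flat (a ++ (some e, h) :: b) := by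
  simp [flat_append, Flat.cons_iff]

lemma not_pinch_of_flat {l : List (Tok H)} (h : Flat l) : ¬ R.Pinch l := by
  rintro ⟨a, e, x, ys, x', b, rfl, -⟩
  exact not_flat_of_some h

lemma not_peelable_of_flat {l : List (Tok H)} {n : ℕ} (h : Flat l) : ¬ R.Peelable n l := by
  rintro ⟨a, e, x, b, rfl, -⟩
  exact not_flat_of_some h

/-- The annotated word of a list of letters followed by base group elements. -/
def ofLetters (s : List (Bool × H)) : List R.Item := s.map fun p => (none, .inr p)

lemma exists_ofLetters (z : List (Tok H)) : ∃ (x : H) (s : List (Bool × H)),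
    R.ev z = R.ι x * R.evI (ofLetters s) ∧ s.length = letters z := by
  induction z with
  | nil => exact ⟨1, [], by simp [ofLetters]⟩
  | cons i z ih =>
    obtain ⟨x, s, h1, h2⟩ := ih
    obtain ⟨_ | e, y⟩ := i
    · exact ⟨y * x, s, by simp [h1, mul_assoc], by simp [h2]⟩
    · exact ⟨1, (e, y * x) :: s, by simp [h1, mul_assoc, ofLetters, tok, dir, val], by simp [h2]⟩

lemma letters_ofLetters (s : List (Bool × H)) :
    letters ((ofLetters s : List R.Item).map tok) = s.length := by
  induction s with
  | nil => rfl
  | cons p s ih => simpa [ofLetters, tok] using ih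

lemma valid_ofLetters (s : List (Bool × H)) (p : Bool × H) :
    Valid (.inr p : R.Corner) (ofLetters s) := by
  induction s generalizing p with
  | nil => trivial
  | cons q s ih => exact ⟨trivial, ih q⟩

lemma swt_ofLetters (s : List (Bool × H)) (p : Bool × H) :
    swt (.inr p : R.Corner) (ofLetters s) = 2 * s.length := by
  induction s generalizing p with
  | nil => rfl
  | cons q s ih =>
    have := ih q
    simp only [ofLetters] at this
    simp only [ofLetters, List.map_cons, swt, cw, lw, this, List.length_cons]
    push_cast; ring

lemma evM_ofLetters (s : List (Bool × H)) (M : List (R.Item × Bool))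
    (h : M.map Prod.fst = ofLetters s) :
    R.evM M = R.evI (ofLetters s) ∧ ∀ b, R.mcs b M = 0 := by
  induction s generalizing M with
  | nil =>
    obtain rfl : M = [] := by simpa [ofLetters] using h
    simp [ofLetters]
  | cons p s ih =>
    obtain ⟨⟨i, b⟩, M, rfl, rfl, h2⟩ := List.map_eq_cons_iff.1 h
    obtain ⟨h3, h4⟩ := ih M h2
    refine ⟨?_, fun b' => ?_⟩
    · rw [evM_cons, h3]
      simp [ofLetters, mv]
    · rw [mcs_cons, h4]
      cases b <;> rfl

lemma inv_ofLetters (s : List (Bool × H)) : Inv (.inr (true, 1) : R.Corner)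
    (R.evI (ofLetters s)) s.length (ofLetters s) 0 where
  valid := valid_ofLetters _ _
  weight := by rw [swt_ofLetters, letters_ofLetters]; push_cast; linarith
  marks M hM _ _ := by
    obtain ⟨h1, h2⟩ := evM_ofLetters s M hM
    exact ⟨0, by simp [h2], by rw [h1, inv_mul_cancel]; exact one_mem_N 0⟩

lemma Inv.weight_le (hk : 2 ≤ R.k) {n : ℕ} {u : List (Tok H)} (hu : Flat u) {c₀ : R.Corner} {e : F}
    {C : ℤ} (hA : ∀ m, R.ev u * e ∈ R.N m → n ≤ m) :
    ∀ d r : ℕ, ∀ (l : List R.Item) (j : ℕ), Inv c₀ e C l j → j + d = n →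
      R.ev u * R.evI l ∈ R.N d → letters (l.map tok) = r → (R.k - 2) * n ≤ C := by
  intro d
  induction d using Nat.strong_induction_on with | _ d ihd
  intro r
  induction r using Nat.strong_induction_on with | _ r ihr
  rintro l j h hj hY rfl
  by_cases hflat : Flat (l.map tok)
  · have hul : Flat (u ++ l.map tok) := flat_append.2 ⟨hu, hflat⟩
    rcases d.eq_zero_or_pos with rfl | hd
    · have h1 := h.weight
      have h2 := swt_nonneg h.valid
      rw [letters_eq_zero.2 hflat] at h1
      rw [add_zero] at hj
      subst hj
      push_cast at h1
      linarith
    · refine absurd (peelable hk d _ (not_pinch_of_flat hul) ⟨?_, fun m hm => ?_⟩ hd)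
        (not_peelable_of_flat hul)
      · rwa [ev_append]
      · rw [ev_append] at hm
        have := hA (m + j) (by
          convert N_mul hm (N_inv h.evI_mem) using 1
          simp only [evI]
          group)
        omega
  rcases h.step (u := u) (v := []) (d := d) (fun m hm => by
    rw [ev_nil, mul_one] at hm
    exact hj ▸ hA m hm) (by simpa using hY) hflat (peelable hk d) with
    ⟨l', h1, h2, h3, -⟩ | ⟨l', d', rfl, h1, h2, -⟩ | ⟨h1, h2⟩ | ⟨h1, h2⟩ |
    ⟨d', rfl, l₁, e, x, l₂, ⟨rfl, -⟩ | ⟨h2, -⟩⟩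
  · exact ihr _ h2 l' j h1 hj (by rwa [h3]) rfl
  · exact ihd d' (by omega) _ l' (j + 1) h1 (by omega) (by simpa using h2) rfl
  · rcases h1.of_append with h1 | h1 | ⟨a, e, x, ys, zs, x', b, rfl, -⟩
    · exact absurd h1 (not_pinch_of_flat hu)
    · exact absurd h1 h2
    · exact absurd hu not_flat_of_some
  · exact absurd (by simpa using h1) h2
  · exact absurd hu not_flat_of_some
  · simp at h2

/-- The linear isoperimetric inequality. -/
theorem Area.le_letters (hk : 3 ≤ R.k) {n : ℕ} {z : List (Tok H)} (h : R.Area (R.ev z) n) :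
    n ≤ letters z := by
  obtain ⟨x, s, h1, h2⟩ := exists_ofLetters (R := R) z
  have h3 := Inv.weight_le (R := R) (by omega) (u := [(none, x)]) (by simp [Flat]) (n := n)
    (fun m hm => by
    refine h.2 m ?_
    rw [h1]
    simpa using hm) n _ _ 0 (inv_ofLetters s) (by omega) (by simpa [← h1] using h.1) rfl
  rw [h2] at h3
  have h4 : (n : ℤ) ≤ (R.k - 2) * n := le_mul_of_one_le_left (by omega) (by omega)
  omega

end Relator
end RelIso

/-! ### HNN extensions -/

namespace RelIso

open HNNData HNNExtension

/-- The exponent of a stable letter of sign `e`. -/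
def unitSign (e : Bool) : ℤˣ := bif e then 1 else -1

lemma unitSign_injective : Function.Injective unitSign := by decide

lemma unitSign_not (e : Bool) : unitSign (!e) = -unitSign e := by cases e <;> rfl

section

variable {H F : Type*} [Group H] [Group F] {A B : Subgroup H} {φ : A ≃* B}
  (f : HNNExtension H A B φ ≃* F)

/-- The decomposition of a group isomorphic to an HNN extension. -/
def hnnData : HNNData H F where
  ι := f.toMonoidHom.comp of
  ι_inj := f.injective.comp (of_injective φ)
  T e := f (t ^ (unitSign e : ℤ))
  T_not e := by rw [unitSign_not, ← map_inv]; simp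
  A e := toSubgroup A B (unitSign e)
  conj e x hx := by
    cases e
    · refine ⟨φ.symm ⟨x, hx⟩, (φ.symm ⟨x, hx⟩).2, ?_⟩
      have := inv_t_mul_of (φ := φ) ⟨x, hx⟩
      simpa [unitSign] using congrArg f this
    · refine ⟨φ ⟨x, hx⟩, (φ ⟨x, hx⟩).2, ?_⟩
      have := t_mul_of (φ := φ) ⟨x, hx⟩
      simpa [unitSign] using congrArg f this

/-- The group element in front of the first stable letter of a word, and the list of stable letters,
each with the group element that follows it. -/
def normalize : List (Tok H) → H × List (ℤˣ × H)
  | [] => (1, [])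
  | (none, h) :: l => (h * (normalize l).1, (normalize l).2)
  | (some e, h) :: l => (1, (unitSign e, h * (normalize l).1) :: (normalize l).2)

lemma normalize_flat_append {a : List (Tok H)} (ha : Flat a) (l : List (Tok H)) :
    normalize (a ++ l) = (hp a * (normalize l).1, (normalize l).2) := by
  induction a with
  | nil => simp
  | cons i a ih =>
    obtain ⟨o, h⟩ := i
    obtain ⟨h1, h2⟩ := Flat.cons_iff.1 ha
    obtain rfl : o = none := h1
    simp [normalize, ih h2, mul_assoc]

lemma exists_of_normalize_eq {l : List (Tok H)} {x : ℤˣ × H} {r : List (ℤˣ × H)}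
    (h : (normalize l).2 = x :: r) :
    ∃ a e h b, l = a ++ (some e, h) :: b ∧ Flat a ∧ x.1 = unitSign e ∧
      hp a = (normalize l).1 := by
  rcases flat_or_split l with hl | ⟨a, e, g, b, ha, rfl⟩
  · have := normalize_flat_append hl []
    simp_all [normalize]
  · rw [normalize_flat_append ha] at h ⊢
    refine ⟨a, e, g, b, rfl, ha, ?_, by simp [normalize]⟩
    simp only [normalize, List.cons.injEq] at h
    rw [← h.1]

lemma isChain_normalize {l : List (Tok H)} (hl : ¬ (hnnData f).Pinch l) :
    (normalize l).2.IsChain fun a b => a.2 ∈ toSubgroup A B a.1 → a.1 = b.1 := by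
  induction l with
  | nil => simp [normalize]
  | cons i l ih =>
    obtain ⟨o, h⟩ := i
    have ih := ih fun h => hl (h.append_left [_])
    cases o with
    | none => exact ih
    | some e =>
      simp only [normalize]
      cases hr : (normalize l).2 with
      | nil => simp
      | cons x r =>
        obtain ⟨a, e', h', b, rfl, ha, hx, h1⟩ := exists_of_normalize_eq hr
        rw [hr] at ih
        refine List.IsChain.cons_cons ?_ ih
        intro hm
        rw [hx]
        by_contra hne
        obtain rfl : e' = !e := by
          cases e <;> cases e' <;> simp_all
        exact hl ⟨[], e, h, a, h', b, rfl, ha, h1 ▸ hm⟩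

lemma ev_normalize (l : List (Tok H)) :
    f (of (normalize l).1 * ((normalize l).2.map fun x => t ^ (x.1 : ℤ) * of x.2).prod) =
      (hnnData f).ev l := by
  induction l with
  | nil => simp [normalize]
  | cons i l ih =>
    obtain ⟨o, h⟩ := i
    rw [ev_cons, ← ih]
    cases o <;> simp [normalize, hnnData, mul_assoc]

/-- The decomposition of a group isomorphic to an HNN extension with malnormal associated
subgroups. -/
def hnnPres (hA : ∀ p ∈ A, p ≠ 1 → ∀ h, h * p * h⁻¹ ∈ A → h ∈ A)
    (hB : ∀ p ∈ B, p ≠ 1 → ∀ h, h * p * h⁻¹ ∈ B → h ∈ B) : HNNPres H F where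
  toHNNData := hnnData f
  gen x := by
    obtain ⟨x, rfl⟩ := f.surjective x
    suffices ∀ x, (∃ l, (hnnData f).ev l = f x) ∧ ∃ l, (hnnData f).ev l = f x⁻¹ from (this x).1
    intro x
    induction x using HNNExtension.induction_on with
    | of g => exact ⟨⟨[(none, g)], by simp [hnnData]⟩, [(none, g⁻¹)], by simp [hnnData]⟩
    | t => exact ⟨⟨[(some true, 1)], by simp [hnnData, unitSign]⟩, [(some false, 1)], by
        simp [hnnData, unitSign]⟩
    | mul x y hx hy =>
      obtain ⟨⟨l, hl⟩, l', hl'⟩ := hx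
      obtain ⟨⟨m, hm⟩, m', hm'⟩ := hy
      exact ⟨⟨l ++ m, by simp [hl, hm]⟩, m' ++ l', by simp [hl', hm']⟩
    | inv x hx => exact ⟨hx.2, by simpa using hx.1⟩
  britton a e h b l hl hl' ha heq := by
    let w₁ : NormalWord.ReducedWord H A B :=
      ⟨(normalize (a ++ (some e, h) :: b)).1, _, isChain_normalize f hl⟩
    let w₂ : NormalWord.ReducedWord H A B :=
      ⟨(normalize l).1, _, isChain_normalize f hl'⟩
    have hprod : w₁.prod φ = w₂.prod φ := by
      rw [← ev_normalize, ← ev_normalize] at heq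
      exact f.injective heq
    obtain ⟨h1, h2⟩ := ReducedWord.map_fst_eq_and_of_prod_eq φ hprod
    simp only [w₁, w₂, normalize_flat_append ha, normalize, mul_one] at h1 h2
    cases hr : (normalize l).2 with
    | nil => simp [hr] at h1
    | cons x r =>
      obtain ⟨a', e', h', b', rfl, ha', hx, h3⟩ := exists_of_normalize_eq hr
      rw [hr] at h1
      simp only [List.map_cons, List.cons.injEq] at h1
      obtain rfl := unitSign_injective (h1.1.trans hx)
      refine ⟨a', h', b', rfl, ha', ?_⟩
      have := h2 (unitSign e) (by simp)
      rw [← h3, ← unitSign_not] at this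
      have h4 := inv_mem this
      rwa [mul_inv_rev, inv_inv] at h4
  malnormal e := by
    cases e
    · exact hB
    · exact hA

end

end RelIso

/-! ### Free factors -/

namespace RelIso

open Monoid Monoid.CoprodI

section

variable {G I J : Type*} [Group G]

/-- The homomorphism between free powers of a group induced by a map of the index sets. -/
def reindex (G : Type*) [Group G] (s : I → J) :
    CoprodI (fun _ : I => G) →* CoprodI (fun _ : J => G) :=
  lift fun i => of (M := fun _ : J => G) (i := s i)

@[simp] lemma reindex_of (s : I → J) (i : I) (g : G) :
    reindex G s (of (M := fun _ : I => G) (i := i) g) =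
      of (M := fun _ : J => G) (i := s i) g := by
  simp [reindex]

lemma of_mem_range_reindex {s : I → J} {j : J} (hj : j ∈ Set.range s) (g : G) :
    of (M := fun _ : J => G) (i := j) g ∈ (reindex G s).range := by
  obtain ⟨i, rfl⟩ := hj
  exact ⟨of (M := fun _ : I => G) (i := i) g, by simp⟩

/-- The reduced word obtained by changing indices. -/
def mapWord {s : I → J} (hs : Function.Injective s) (w : Word fun _ : I => G) :
    Word fun _ : J => G where
  toList := w.toList.map fun x => ⟨s x.1, x.2⟩
  ne_one := by
    intro l hl
    obtain ⟨x, hx, rfl⟩ := List.mem_map.1 hl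
    exact w.ne_one x hx
  chain_ne := by
    rw [List.isChain_map]
    exact w.chain_ne.imp fun _ _ h h' => h (hs h')

lemma prod_mapWord {s : I → J} (hs : Function.Injective s) (w : Word fun _ : I => G) :
    (mapWord hs w).prod = reindex G s w.prod := by
  simp only [Word.prod, mapWord, map_list_prod, List.map_map]
  congr 1

lemma word_prod_injective : Function.Injective (Word.prod : (Word fun _ : J => G) → _) := by
  classical
  exact Word.equiv.symm.injective

lemma exists_word_prod (x : CoprodI fun _ : J => G) : ∃ w : Word fun _ : J => G, w.prod = x := by
  classical
  exact Word.equiv.symm.surjective x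

lemma mem_range_of_mem_toList {s : I → J} (hs : Function.Injective s) {w : Word fun _ : J => G}
    (hw : w.prod ∈ (reindex G s).range) {x : Σ _ : J, G} (hx : x ∈ w.toList) :
    x.1 ∈ Set.range s := by
  obtain ⟨y, hy⟩ := hw
  obtain ⟨v, rfl⟩ := exists_word_prod y
  rw [← prod_mapWord hs] at hy
  rw [← word_prod_injective hy] at hx
  obtain ⟨z, -, rfl⟩ := List.mem_map.1 hx
  exact ⟨z.1, rfl⟩

lemma NeWord.fst_mem_toList {i j : J} (w : NeWord (fun _ : J => G) i j) :
    ⟨i, w.head⟩ ∈ w.toList :=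
  List.mem_of_head? w.toList_head?

lemma NeWord.snd_mem_toList {i j : J} (w : NeWord (fun _ : J => G) i j) :
    ⟨j, w.last⟩ ∈ w.toList :=
  List.mem_of_getLast? w.toList_getLast?

lemma conj_notMem_range {s : I → J} (hs : Function.Injective s) {i j : J}
    (h : NeWord (fun _ : J => G) i j) (hi : i ∉ Set.range s) (hj : j ∉ Set.range s)
    {p : CoprodI fun _ : J => G} (hp : p ∈ (reindex G s).range) (hp1 : p ≠ 1) :
    h.prod * p * h.prod⁻¹ ∉ (reindex G s).range := by
  obtain ⟨v, rfl⟩ := exists_word_prod p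
  obtain ⟨k, l, v, rfl⟩ := NeWord.of_word v (by rintro rfl; simp at hp1)
  have hk := mem_range_of_mem_toList hs hp (NeWord.fst_mem_toList v)
  have hl := mem_range_of_mem_toList hs hp (NeWord.snd_mem_toList v)
  have hlj : l ≠ j := fun e => hj (e ▸ hl)
  let u := (h.append (fun e => hj (e ▸ hk)) v).append hlj h.inv
  have hu : h.prod * v.toWord.prod * h.prod⁻¹ = u.toWord.prod := by
    change _ = u.prod
    simp only [u, NeWord.append_prod, NeWord.inv_prod]
    rfl
  rw [hu]
  intro hm
  exact hi (mem_range_of_mem_toList hs hm (NeWord.fst_mem_toList u))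

/-- Free factors are malnormal. -/
theorem malnormal_range_reindex {s : I → J} (hs : Function.Injective s) :
    ∀ p ∈ (reindex G s).range, p ≠ 1 → ∀ h, h * p * h⁻¹ ∈ (reindex G s).range →
      h ∈ (reindex G s).range := by
  suffices ∀ (n : ℕ) (w : Word fun _ : J => G), w.toList.length = n → ∀ p ∈ (reindex G s).range,
      p ≠ 1 → w.prod * p * w.prod⁻¹ ∈ (reindex G s).range → w.prod ∈ (reindex G s).range by
    intro p hp hp1 h hh
    obtain ⟨w, rfl⟩ := exists_word_prod h
    exact this _ w rfl p hp hp1 hh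
  intro n
  induction n with
  | zero =>
    intro w hw p _ _ _
    rw [List.length_eq_zero_iff] at hw
    simp [Word.prod, hw, one_mem]
  | succ n ih =>
    intro w hw p hp hp1 hh
    obtain ⟨i, j, v, rfl⟩ := NeWord.of_word w (by rintro rfl; simp [Word.empty] at hw)
    by_cases hi : i ∈ Set.range s
    · obtain ⟨l, hl⟩ := List.head?_eq_some_iff.1 v.toList_head?
      have hw' : v.toWord.toList = ⟨i, v.head⟩ :: l := hl
      let u : Word fun _ : J => G := ⟨l, fun x hx => v.toWord.ne_one x (by simp [hw', hx]), by
        have := v.toWord.chain_ne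
        rw [hw'] at this
        exact this.tail⟩
      have hu : v.toWord.prod = of (M := fun _ : J => G) (i := i) v.head * u.prod := by
        simp [Word.prod, hw', u]
      have hm := of_mem_range_reindex hi v.head
      rw [hu] at hh ⊢
      refine mul_mem hm (ih u (by simpa [hw'] using hw) p hp hp1 ?_)
      convert mul_mem (mul_mem (inv_mem hm) hh) hm using 1
      group
    by_cases hj : j ∈ Set.range s
    · obtain ⟨l, hl⟩ := List.getLast?_eq_some_iff.1 v.toList_getLast?
      have hw' : v.toWord.toList = l ++ [⟨j, v.last⟩] := hl
      let u : Word fun _ : J => G := ⟨l, fun x hx => v.toWord.ne_one x (by simp [hw', hx]), by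
        have := v.toWord.chain_ne
        rw [hw'] at this
        exact this.left_of_append⟩
      have hu : v.toWord.prod = u.prod * of (M := fun _ : J => G) (i := j) v.last := by
        simp [Word.prod, hw', u]
      have hm := of_mem_range_reindex hj v.last
      rw [hu] at hh ⊢
      refine mul_mem (ih u (by simpa [hw'] using hw) _ (mul_mem (mul_mem hm hp) (inv_mem hm))
        (by simpa using hp1) ?_) hm
      convert hh using 1
      group
    exact absurd hh (conj_notMem_range hs v hi hj hp hp1)

end

end RelIso

/-! ### The decompositions of the free product with an infinite cyclic group -/

namespace RelIso

open Monoid Monoid.CoprodI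

lemma reindex_injective {G I J : Type*} [Group G] {s : I → J} (hs : Function.Injective s) :
    Function.Injective (reindex G s) := by
  intro x y h
  obtain ⟨v, rfl⟩ := exists_word_prod x
  obtain ⟨w, rfl⟩ := exists_word_prod y
  rw [← prod_mapWord hs, ← prod_mapWord hs] at h
  have h1 := congrArg Word.toList (word_prod_injective h)
  congr 1
  refine Word.ext (List.map_injective_iff.2 ?_ h1)
  rintro ⟨i, a⟩ ⟨j, b⟩ hab
  simp only [Sigma.mk.injEq] at hab
  obtain ⟨h1, h2⟩ := hab
  obtain rfl := hs h1
  obtain rfl := eq_of_heq h2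
  rfl

variable (G : Type*) [Group G] (n : ℕ)

/-- The free product of `n + 1` copies of `G`. -/
abbrev Base := CoprodI fun _ : Fin (n + 1) => G

/-- The free product of the first `n` copies of `G`. -/
abbrev lower : Subgroup (Base G n) := (reindex G (Fin.castSucc (n := n))).range

/-- The free product of the last `n` copies of `G`. -/
abbrev upper : Subgroup (Base G n) := (reindex G (Fin.succ (n := n))).range

/-- The shift of indices. -/
noncomputable def shift : lower G n ≃* upper G n :=
  (MonoidHom.ofInjective (reindex_injective (Fin.castSucc_injective n))).symm.trans
    (MonoidHom.ofInjective (reindex_injective (Fin.succ_injective n)))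

variable {G n} in
lemma shift_apply (x : CoprodI fun _ : Fin n => G) :
    shift G n ⟨reindex G Fin.castSucc x, x, rfl⟩ = ⟨reindex G Fin.succ x, x, rfl⟩ := by
  have h : (MonoidHom.ofInjective (reindex_injective (G := G) (Fin.castSucc_injective n))).symm
      ⟨reindex G Fin.castSucc x, x, rfl⟩ = x := by
    rw [MulEquiv.symm_apply_eq]
    rfl
  simp only [shift, MulEquiv.trans_apply, h]
  rfl

/-- The embedding of the free product of `n + 1` copies of `G` that sends the `i`-th copy to the
conjugate of `G` by `t ^ i`. -/
def baseHom : Base G n →* FP G :=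
  CoprodI.lift fun i => (MulAut.conj (tgen G ^ (i : ℕ))).toMonoidHom.comp (emb G)

variable {G n}

@[simp] lemma baseHom_of (i : Fin (n + 1)) (g : G) :
    baseHom G n (of (M := fun _ : Fin (n + 1) => G) (i := i) g) =
      tgen G ^ (i : ℕ) * emb G g * (tgen G ^ (i : ℕ))⁻¹ := by
  simp [baseHom, -map_pow]

lemma tgen_mul_baseHom (x : CoprodI fun _ : Fin n => G) :
    tgen G * baseHom G n (reindex G Fin.castSucc x) =
      baseHom G n (reindex G Fin.succ x) * tgen G := by
  have h : (MulAut.conj (tgen G)).toMonoidHom.comp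
      ((baseHom G n).comp (reindex G Fin.castSucc)) =
      (baseHom G n).comp (reindex G Fin.succ) := by
    refine CoprodI.ext_hom _ _ fun i => MonoidHom.ext fun g => ?_
    simp [pow_succ', mul_assoc]
  have h1 := DFunLike.congr_fun h x
  exact mul_inv_eq_iff_eq_mul.1 h1

variable (G n)

/-- The map from the HNN extension to the free product. -/
noncomputable def fromHNN : HNNExtension (Base G n) (lower G n) (upper G n) (shift G n) →* FP G :=
  HNNExtension.lift (baseHom G n) (tgen G) <| by
    rintro ⟨_, x, rfl⟩
    rw [shift_apply]
    exact tgen_mul_baseHom x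

/-- The map from the free product to the HNN extension. -/
noncomputable def toHNN : FP G →* HNNExtension (Base G n) (lower G n) (upper G n) (shift G n) :=
  Coprod.lift (HNNExtension.of.comp (of (M := fun _ : Fin (n + 1) => G) (i := 0)))
    (FreeGroup.lift fun _ => HNNExtension.t)

lemma toHNN_tgen : toHNN G n (tgen G) = HNNExtension.t := by
  simp [toHNN, tgen]

lemma toHNN_emb (g : G) : toHNN G n (emb G g) =
    HNNExtension.of (of (M := fun _ : Fin (n + 1) => G) (i := 0) g) := by
  simp [toHNN, emb]

lemma of_of_eq (i : Fin (n + 1)) (g : G) :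
    HNNExtension.of (φ := shift G n) (of (M := fun _ : Fin (n + 1) => G) (i := i) g) =
      HNNExtension.t ^ (i : ℕ) *
        HNNExtension.of (of (M := fun _ : Fin (n + 1) => G) (i := 0) g) *
        (HNNExtension.t ^ (i : ℕ))⁻¹ := by
  induction i using Fin.induction with
  | zero => simp
  | succ i ih =>
    have h := HNNExtension.t_mul_of (φ := shift G n)
      ⟨_, of (M := fun _ : Fin n => G) (i := i) g, rfl⟩
    rw [shift_apply] at h
    simp only [reindex_of] at h
    rw [← mul_inv_eq_iff_eq_mul, ih] at h
    rw [← h, Fin.val_succ, Fin.val_castSucc]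
    group

/-- The free product as an HNN extension. -/
noncomputable def hnnEquiv :
    HNNExtension (Base G n) (lower G n) (upper G n) (shift G n) ≃* FP G :=
  MonoidHom.toMulEquiv (fromHNN G n) (toHNN G n)
    (by
      refine HNNExtension.hom_ext ?_ ?_
      · refine CoprodI.ext_hom _ _ fun i => MonoidHom.ext fun g => ?_
        simp [fromHNN, toHNN_tgen, toHNN_emb, of_of_eq G n i]
      · simp [fromHNN, toHNN_tgen])
    (by
      refine Coprod.hom_ext ?_ ?_
      · refine MonoidHom.ext fun g => ?_
        have := toHNN_emb G n g
        simp only [emb] at this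
        simp [this, fromHNN, emb]
      · refine FreeGroup.ext_hom _ _ fun i => ?_
        have := toHNN_tgen G n
        simp only [tgen] at this
        simp [this, fromHNN, tgen])

/-- The free product decomposed with base group the free product of `n + 1` copies of `G`. -/
noncomputable def pres : HNNPres (Base G n) (FP G) :=
  hnnPres (hnnEquiv G n) (malnormal_range_reindex (Fin.castSucc_injective n))
    (malnormal_range_reindex (Fin.succ_injective n))

@[simp] lemma pres_ι : (pres G n).ι = baseHom G n := by
  refine MonoidHom.ext fun x => ?_
  change fromHNN G n (HNNExtension.of x) = _
  simp [fromHNN]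

@[simp] lemma pres_T_true : (pres G n).T true = tgen G := by
  change fromHNN G n (HNNExtension.t ^ ((1 : ℤˣ) : ℤ)) = _
  simp [fromHNN]

@[simp] lemma pres_T_false : (pres G n).T false = (tgen G)⁻¹ := by
  change fromHNN G n (HNNExtension.t ^ ((-1 : ℤˣ) : ℤ)) = _
  simp [fromHNN]

lemma pres_A_true : (pres G n).A true = lower G n := rfl

lemma pres_A_false : (pres G n).A false = upper G n := rfl

end RelIso

/-! ### Conjugates of unimodular words -/

namespace RelIso

open Monoid Monoid.CoprodI

variable {G : Type*} [Group G] {n : ℕ}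

lemma baseHom_castSucc (x : Base G n) :
    baseHom G (n + 1) (reindex G Fin.castSucc x) = baseHom G n x := by
  have h : (baseHom G (n + 1)).comp (reindex G Fin.castSucc) = baseHom G n := by
    refine CoprodI.ext_hom _ _ fun i => MonoidHom.ext fun g => ?_
    simp
  exact DFunLike.congr_fun h x

lemma range_baseHom_mono : Monotone fun n => (baseHom G n).range := by
  refine monotone_nat_of_le_succ fun n => ?_
  rintro _ ⟨x, rfl⟩
  exact ⟨_, baseHom_castSucc x⟩

lemma tgen_conj_mem {f : FP G} (hf : f ∈ (baseHom G n).range) :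
    tgen G * f * (tgen G)⁻¹ ∈ (baseHom G (n + 1)).range := by
  obtain ⟨x, rfl⟩ := hf
  have := tgen_mul_baseHom (n := n + 1) x
  rw [baseHom_castSucc] at this
  exact ⟨_, (mul_inv_eq_iff_eq_mul.2 this).symm⟩

lemma expSum_baseHom (x : Base G n) : expSum G (baseHom G n x) = 1 := by
  have h : (expSum G).comp (baseHom G n) = 1 := by
    refine CoprodI.ext_hom _ _ fun i => MonoidHom.ext fun g => ?_
    simp [expSum, emb]
  exact DFunLike.congr_fun h x

lemma expSum_tgen : expSum G (tgen G) = Multiplicative.ofAdd 1 := by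
  simp [expSum, tgen]

lemma exists_shift_mem_range (f : FP G) :
    ∃ M i k : ℕ, tgen G ^ M * f * (tgen G ^ i)⁻¹ ∈ (baseHom G k).range := by
  suffices ∀ y f : FP G, (∃ M i k : ℕ, tgen G ^ M * f * (tgen G ^ i)⁻¹ ∈ (baseHom G k).range) →
      ∃ M i k : ℕ, tgen G ^ M * (f * y) * (tgen G ^ i)⁻¹ ∈ (baseHom G k).range by
    simpa using this f 1 ⟨0, 0, 0, by simp [one_mem]⟩
  intro y
  induction y using Coprod.induction_on with
  | mul x y hx hy =>
    intro f hf
    simpa only [mul_assoc] using hy _ (hx _ hf)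
  | inl g =>
    rintro f ⟨M, i, k, h⟩
    refine ⟨M, i, k + i, ?_⟩
    have h1 : tgen G ^ i * emb G g * (tgen G ^ i)⁻¹ ∈ (baseHom G (k + i)).range :=
      ⟨of (M := fun _ => G) (i := ⟨i, by omega⟩) g, by simp⟩
    convert mul_mem (range_baseHom_mono (Nat.le_add_right k i) h) h1 using 1
    simp [mul_assoc, emb]
  | inr y =>
    induction y using FreeGroup.induction_on with
    | C1 => intro f hf; simpa using hf
    | of _ =>
      rintro f ⟨M, i, k, h⟩
      refine ⟨M, i + 1, k, ?_⟩
      convert h using 1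
      change _ * (_ * tgen G) * _ = _
      group
    | inv_of _ _ =>
      rintro f ⟨M, i, k, h⟩
      refine ⟨M + 1, i, k + 1, ?_⟩
      convert tgen_conj_mem h using 1
      rw [map_inv]
      change _ * (_ * (tgen G)⁻¹) * _ = _
      group
    | mul x y hx hy =>
      intro f hf
      rw [map_mul, ← mul_assoc]
      exact hy _ (hx _ hf)

/-- Products of an element of the base group and `r` factors `t * x * t⁻¹ * y` with `x`, `y` in the
base group. -/
inductive Form (n : ℕ) : ℕ → FP G → Prop
  | base (x : Base G n) : Form n 0 (baseHom G n x)
  | step {r : ℕ} {f : FP G} (hf : Form n r f) (x y : Base G n) :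
      Form n (r + 1) (f * (tgen G * baseHom G n x * (tgen G)⁻¹ * baseHom G n y))

namespace Form

lemma one : Form n 0 (1 : FP G) := by simpa using Form.base (G := G) (n := n) 1

lemma single (x y : Base G n) :
    Form n 1 (tgen G * baseHom G n x * (tgen G)⁻¹ * baseHom G n y) := by
  simpa using one.step x y

lemma mul_base {r : ℕ} {f : FP G} (hf : Form n r f) (z : Base G n) :
    Form n r (f * baseHom G n z) := by
  cases hf with
  | base x => rw [← map_mul]; exact base _
  | step hf x y => simpa [mul_assoc] using hf.step x (y * z)

lemma mul {r s : ℕ} {f g : FP G} (hf : Form n r f) (hg : Form n s g) :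
    Form n (r + s) (f * g) := by
  induction hg with
  | base x => exact hf.mul_base x
  | step _ x y ih => rw [← mul_assoc]; exact ih.step x y

lemma base_mul {r : ℕ} {f : FP G} (hf : Form n r f) (z : Base G n) :
    Form n r (baseHom G n z * f) := by
  simpa using (base z).mul hf

lemma exists_of_base_succ (x : Base G (n + 1)) : ∃ r, Form n r (baseHom G (n + 1) x) := by
  induction x using CoprodI.induction_on with
  | one => exact ⟨0, by simpa using one⟩
  | of i g =>
    induction i using Fin.lastCases with
    | last =>
      refine ⟨1, ?_⟩
      convert single (of (M := fun _ : Fin (n + 1) => G) (i := Fin.last n) g) 1 using 1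
      simp [pow_succ', mul_assoc]
    | cast i =>
      refine ⟨0, ?_⟩
      convert base (of (M := fun _ : Fin (n + 1) => G) (i := i) g) using 1
      simp
  | mul x y hx hy =>
    obtain ⟨r, hr⟩ := hx
    obtain ⟨s, hs⟩ := hy
    exact ⟨r + s, by rw [map_mul]; exact hr.mul hs⟩

end Form

/-- `w` is conjugate to `f * t` with `f` of the form `Form n r`. -/
def Rep (n r : ℕ) (w : FP G) : Prop := ∃ u f, Form n r f ∧ u * w * u⁻¹ = f * tgen G

lemma exists_rep {w : FP G} (hw : Unimodular w) : ∃ n, Rep n 0 w := by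
  obtain ⟨M, i, k, x, hx⟩ := exists_shift_mem_range w
  have h1 := congrArg (expSum G) hx
  rw [expSum_baseHom, map_mul, map_mul, map_inv, map_pow, map_pow, expSum_tgen, hw] at h1
  have h2 : i = M + 1 := by
    have := congrArg Multiplicative.toAdd h1
    simp at this
    omega
  subst h2
  refine ⟨k, tgen G ^ M, _, .base x, ?_⟩
  rw [hx]
  group

lemma Rep.lower_base {w : FP G} (h : Rep (n + 1) 0 w) : ∃ r, Rep n r w := by
  obtain ⟨u, f, hf, h⟩ := h
  cases hf with
  | base x =>
    obtain ⟨r, hr⟩ := Form.exists_of_base_succ x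
    exact ⟨r, u, _, hr, h⟩

/-- The product of the first `m` factors of an alternating word. -/
noncomputable def alt (g : ℕ → Base G n) : ℕ → FP G
  | 0 => 1
  | m + 1 => alt g m * ((pres G n).T (!m.bodd) * baseHom G n (g m))

lemma alt_congr {g g' : ℕ → Base G n} {m : ℕ} (h : ∀ i < m, g i = g' i) : alt g m = alt g' m := by
  induction m with
  | zero => rfl
  | succ m ih => simp only [alt]; rw [ih fun i hi => h i (by omega), h m (by omega)]

lemma alt_two_mul_succ (g : ℕ → Base G n) (m : ℕ) :
    alt g (2 * (m + 1)) = alt g (2 * m) *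
      (tgen G * baseHom G n (g (2 * m)) * (tgen G)⁻¹ * baseHom G n (g (2 * m + 1))) := by
  simp [mul_add, alt, mul_assoc]

lemma alt_two_mul_add_one (g : ℕ → Base G n) (m : ℕ) :
    alt g (2 * m + 1) = alt g (2 * m) * (tgen G * baseHom G n (g (2 * m))) := by
  simp [alt]

lemma form_alt (g : ℕ → Base G n) (m : ℕ) : Form n m (alt g (2 * m)) := by
  induction m with
  | zero => exact .one
  | succ m ih => rw [alt_two_mul_succ]; exact ih.step _ _

lemma exists_form_alt (g : ℕ → Base G n) (m s : ℕ) :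
    ∃ f, Form n s f ∧ alt g (2 * (m + s)) = alt g (2 * m) * f := by
  induction s with
  | zero => exact ⟨1, .one, by simp⟩
  | succ s ih =>
    obtain ⟨f, hf, h⟩ := ih
    exact ⟨_, hf.step _ _, by rw [← add_assoc, alt_two_mul_succ, h, mul_assoc]⟩

lemma Form.exists_alt {r : ℕ} {f : FP G} (hf : Form n r f) :
    ∃ (g : ℕ → Base G n) (c : Base G n), f = baseHom G n c * alt g (2 * r) := by
  induction hf with
  | base x => exact ⟨1, x, by simp [alt]⟩
  | @step r f _ x y ih =>
    obtain ⟨g, c, rfl⟩ := ih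
    refine ⟨fun i => if i < 2 * r then g i else if i = 2 * r then x else y, c, ?_⟩
    rw [alt_two_mul_succ, mul_assoc, alt_congr (g := g) (g' := fun i => if i < 2 * r then g i
      else if i = 2 * r then x else y)]
    · simp
    · intro i hi
      simp [hi]

lemma Rep.exists_alt {r : ℕ} {w : FP G} (h : Rep n r w) :
    ∃ g u, u * w * u⁻¹ = alt (n := n) g (2 * r + 1) := by
  obtain ⟨u, f, hf, h⟩ := h
  obtain ⟨g, c, rfl⟩ := hf.exists_alt
  refine ⟨fun i => if i < 2 * r then g i else c, (baseHom G n c)⁻¹ * u, ?_⟩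
  rw [alt_two_mul_add_one, alt_congr (g' := g)]
  · simp only [lt_self_iff_false, if_false]
    rw [mul_inv_rev, inv_inv]
    calc _ = (baseHom G n c)⁻¹ * (u * w * u⁻¹) * baseHom G n c := by group
      _ = _ := by rw [h]; group
  · intro i hi
    simp [hi]

lemma rep_of_form {r : ℕ} {w u f : FP G} {x : Base G n} (hf : Form n r f)
    (h : u * w * u⁻¹ = f * (tgen G * baseHom G n x)) : Rep n r w := by
  refine ⟨baseHom G n x * u, _, hf.base_mul x, ?_⟩
  rw [mul_inv_rev]
  calc _ = baseHom G n x * (u * w * u⁻¹) * (baseHom G n x)⁻¹ := by group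
    _ = _ := by rw [h]; group

lemma exists_conj_of_mem_lower {x : Base G n} (h : x ∈ lower G n) :
    ∃ y, tgen G * baseHom G n x * (tgen G)⁻¹ = baseHom G n y := by
  obtain ⟨y, -, hy⟩ := (pres G n).conj true x h
  exact ⟨y, by simpa [mul_inv_eq_iff_eq_mul] using hy⟩

lemma exists_conj_of_mem_upper {x : Base G n} (h : x ∈ upper G n) :
    ∃ y, (tgen G)⁻¹ * baseHom G n x * tgen G = baseHom G n y := by
  obtain ⟨y, -, hy⟩ := (pres G n).conj false x h
  exact ⟨y, by simpa [eq_mul_inv_iff_mul_eq] using hy⟩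

lemma notMem_of_minimal {r : ℕ} {w u : FP G} {g : ℕ → Base G n}
    (hmin : ∀ s, Rep n s w → r ≤ s) (h : u * w * u⁻¹ = alt g (2 * r + 1)) {i : ℕ}
    (hi : i < 2 * r) : g i ∉ (pres G n).A (!i.bodd) := by
  intro hm
  rw [alt_two_mul_add_one] at h
  rcases Nat.even_or_odd' i with ⟨j, rfl | rfl⟩
  · have hm : g (2 * j) ∈ lower G n := by simpa [pres_A_true] using hm
    obtain ⟨y, hy⟩ := exists_conj_of_mem_lower hm
    obtain ⟨s, rfl⟩ : ∃ s, r = j + 1 + s := ⟨r - j - 1, by omega⟩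
    obtain ⟨f, hf, h1⟩ := exists_form_alt g (j + 1) s
    rw [h1, alt_two_mul_succ, hy, ← mul_assoc (alt g (2 * j))] at h
    have := hmin _ (rep_of_form ((((form_alt g j).mul_base _).mul_base _).mul hf) h)
    omega
  · have hm : g (2 * j + 1) ∈ upper G n := by simpa [pres_A_false] using hm
    obtain ⟨y, hy⟩ := exists_conj_of_mem_upper hm
    rcases Nat.eq_or_lt_of_le (show j + 1 ≤ r by omega) with rfl | hj
    · rw [alt_two_mul_succ] at h
      have h2 : u * w * u⁻¹ = alt g (2 * j) * (tgen G *
          baseHom G n (g (2 * j) * y * g (2 * (j + 1)))) := by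
        rw [h, map_mul, map_mul, ← hy]; group
      have := hmin _ (rep_of_form (form_alt g j) h2)
      omega
    · obtain ⟨s, rfl⟩ : ∃ s, r = j + 1 + 1 + s := ⟨r - j - 2, by omega⟩
      obtain ⟨f, hf, h1⟩ := exists_form_alt g (j + 1 + 1) s
      have h2 : alt g (2 * (j + 1 + 1)) = alt g (2 * j) * (tgen G *
          baseHom G n (g (2 * j) * y * g (2 * (j + 1))) * (tgen G)⁻¹ *
          baseHom G n (g (2 * (j + 1) + 1))) := by
        rw [alt_two_mul_succ, alt_two_mul_succ, map_mul, map_mul, ← hy]; group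
      rw [h1, h2] at h
      have := hmin _ (rep_of_form (((form_alt g j).step _ _).mul hf) h)
      omega

/-- A unimodular word is conjugate to an alternating word that cannot be shortened. -/
theorem exists_alt {w : FP G} (hw : Unimodular w) :
    ∃ (n r : ℕ) (g : ℕ → Base G n) (u : FP G), u * w * u⁻¹ = alt g (2 * r + 1) ∧
      (∀ i < 2 * r, g i ∉ (pres G n).A (!i.bodd)) ∧ (r = 0 → n = 0) := by
  classical
  have h : ∃ n r, Rep n r w := by
    obtain ⟨n, hn⟩ := exists_rep hw
    exact ⟨n, 0, hn⟩
  have hr := Nat.find_spec h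
  obtain ⟨g, u, hu⟩ := (Nat.find_spec hr).exists_alt
  refine ⟨_, _, g, u, hu, fun i hi => notMem_of_minimal (fun s hs => Nat.find_min' hr hs) hu hi, ?_⟩
  intro h0
  by_contra hne
  obtain ⟨m, hm⟩ := Nat.exists_eq_succ_of_ne_zero hne
  have h1 := Nat.find_spec hr
  rw [h0] at h1
  have h2 : Rep (m + 1) 0 w := by rwa [← Nat.succ_eq_add_one, ← hm]
  have := Nat.find_min' h h2.lower_base
  omega

end RelIso

/-! ### The relator -/

namespace RelIso

open scoped Fin.NatCast Fin.CommRing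

section

variable {r : ℕ}

/-- The next letter of a cyclic word and of its inverse. -/
def nextPos (a : Bool × Fin (2 * r + 1)) : Bool × Fin (2 * r + 1) :=
  (a.1, bif a.1 then a.2 + 1 else a.2 - 1)

/-- The last letter of the cyclic word and of its inverse. -/
def isLastPos (a : Bool × Fin (2 * r + 1)) : Bool :=
  bif a.1 then decide (a.2 = Fin.last _) else decide (a.2 = 0)

/-- The weights of the edges. -/
def edgeWeight (a : Bool × Fin (2 * r + 1)) : ℤ :=
  (bif a.1 then 1 else -1) * ((if a.2 = 0 then 1 else 0) - if a.2 = Fin.last _ then 1 else 0)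

/-- The signs of the letters. -/
def letterSign (a : Bool × Fin (2 * r + 1)) : Bool := a.1 ^^ a.2.val.bodd

lemma nextPos_iterate_true (i : Fin (2 * r + 1)) (m : ℕ) :
    nextPos^[m] (true, i) = (true, i + m) := by
  induction m with
  | zero => simp
  | succ m ih => rw [Function.iterate_succ_apply', ih]; simp [nextPos, add_assoc]

lemma nextPos_iterate_false (i : Fin (2 * r + 1)) (m : ℕ) :
    nextPos^[m] (false, i) = (false, i - m) := by
  induction m with
  | zero => simp
  | succ m ih => rw [Function.iterate_succ_apply', ih]; simp [nextPos, sub_sub]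

lemma nextPos_iterate_card (a : Bool × Fin (2 * r + 1)) : nextPos^[2 * r + 1] a = a := by
  obtain ⟨s, i⟩ := a
  have h : ((2 * r + 1 : ℕ) : Fin (2 * r + 1)) = 0 := Fin.natCast_self _
  cases s
  · rw [nextPos_iterate_false, h, sub_zero]
  · rw [nextPos_iterate_true, h, add_zero]

lemma nextPos_iterate_mul (a : Bool × Fin (2 * r + 1)) (k : ℕ) :
    nextPos^[k * (2 * r + 1)] a = a := by
  induction k with
  | zero => simp
  | succ k ih => rw [Nat.succ_mul k, Function.iterate_add_apply, nextPos_iterate_card, ih]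

lemma exists_isLastPos (a : Bool × Fin (2 * r + 1)) :
    ∃ m < 2 * r + 1, isLastPos (nextPos^[m] a) := by
  obtain ⟨s, i⟩ := a
  cases s
  · refine ⟨i.val, i.isLt, ?_⟩
    rw [nextPos_iterate_false]
    simp [isLastPos]
  · refine ⟨(Fin.last _ - i).val, (Fin.last _ - i).isLt, ?_⟩
    rw [nextPos_iterate_true]
    simp [isLastPos]

lemma le_sum_isLastPos (a : Bool × Fin (2 * r + 1)) (k : ℕ) :
    k ≤ ∑ i ∈ Finset.range (k * (2 * r + 1)), if isLastPos (nextPos^[i] a) then 1 else 0 := by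
  induction k with
  | zero => simp
  | succ k ih =>
    rw [add_mul, one_mul, Finset.sum_range_add]
    refine add_le_add ih ?_
    obtain ⟨m, hm, h⟩ := exists_isLastPos a
    refine le_trans ?_ (Finset.single_le_sum (fun _ _ => Nat.zero_le _) (Finset.mem_range.2 hm))
    rw [Nat.add_comm _ m, Function.iterate_add_apply, nextPos_iterate_mul, if_pos h]

lemma val_add_one_of_ne {i : Fin (2 * r + 1)} (h : i ≠ Fin.last _) :
    (i + 1).val = i.val + 1 := by
  rw [Fin.val_add_one, if_neg h]

lemma val_sub_one_of_ne {i : Fin (2 * r + 1)} (h : i ≠ 0) : (i - 1).val + 1 = i.val := by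
  rw [Fin.coe_sub_one, if_neg h]
  have : i.val ≠ 0 := fun e => h (Fin.ext e)
  omega

lemma add_one_eq_zero {i : Fin (2 * r + 1)} : i + 1 = 0 ↔ i = Fin.last _ := by
  constructor
  · intro h
    by_contra hi
    have := val_add_one_of_ne hi
    simp [h] at this
  · rintro rfl; simp

lemma letterSign_nextPos (a : Bool × Fin (2 * r + 1)) :
    letterSign (nextPos a) = if isLastPos a then letterSign a else !letterSign a := by
  obtain ⟨s, i⟩ := a
  cases s
  · by_cases h : i = 0
    · subst h
      simp [letterSign, nextPos, isLastPos]
    · have := val_sub_one_of_ne h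
      simp [letterSign, nextPos, isLastPos, h, ← this]
  · by_cases h : i = Fin.last _
    · subst h
      simp [letterSign, nextPos, isLastPos]
    · have := val_add_one_of_ne h
      simp [letterSign, nextPos, isLastPos, h, this]

lemma edgeWeight_nextPos_of_isLastPos (hr : r ≠ 0) {a : Bool × Fin (2 * r + 1)}
    (h : isLastPos a) : edgeWeight (nextPos a) = 1 := by
  have h1 : (0 : Fin (2 * r + 1)) ≠ Fin.last _ := by
    intro e
    have := congrArg Fin.val e
    simp at this
    exact hr this
  obtain ⟨s, i⟩ := a
  cases s
  · obtain rfl : i = 0 := by simpa [isLastPos] using h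
    have h2 : (0 : Fin (2 * r + 1)) - 1 = Fin.last _ := by
      rw [sub_eq_iff_eq_add]; simp
    simp only [edgeWeight, nextPos, cond_false, h2, if_neg h1.symm, if_true]
    norm_num
  · obtain rfl : i = Fin.last _ := by simpa [isLastPos] using h
    simp [edgeWeight, nextPos, h1]

lemma edgeWeight_nextPos_of_not_isLastPos {a : Bool × Fin (2 * r + 1)}
    (h : isLastPos a = false) : edgeWeight (nextPos a) = 0 ∨ edgeWeight (nextPos a) = -1 := by
  obtain ⟨s, i⟩ := a
  cases s
  · have h : i ≠ 0 := by simpa [isLastPos] using h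
    have h2 : i - 1 ≠ Fin.last _ := by
      rw [ne_eq, ← add_one_eq_zero, sub_add_cancel]; exact h
    by_cases h3 : i - 1 = 0 <;> by_cases hr : r = 0 <;>
      simp [edgeWeight, nextPos, h2, h3, hr]
  · have h : i ≠ Fin.last _ := by simpa [isLastPos] using h
    have h2 : i + 1 ≠ 0 := by rwa [ne_eq, add_one_eq_zero]
    by_cases h3 : i + 1 = Fin.last _ <;> by_cases hr : r = 0 <;>
      simp [edgeWeight, nextPos, h2, h3, hr]

lemma edgeWeight_consecutive {a : Bool × Fin (2 * r + 1)} (h : isLastPos a = false)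
    (h1 : edgeWeight a = 1) : edgeWeight (nextPos a) ≠ -1 := by
  obtain ⟨s, i⟩ := a
  cases s
  · have h : i ≠ 0 := by simpa [isLastPos] using h
    have h2 : i = Fin.last _ := by
      by_contra h2
      simp [edgeWeight, h, h2] at h1
    have h3 := val_sub_one_of_ne h
    have h4 : i - 1 ≠ 0 := by
      intro e
      rw [e, h2] at h3
      simp at h3
      omega
    by_cases h5 : i - 1 = Fin.last _ <;> by_cases hr : r = 0 <;>
      simp [edgeWeight, nextPos, h4, h5, hr]
  · have h : i ≠ Fin.last _ := by simpa [isLastPos] using h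
    have h2 : i = 0 := by
      by_contra h2
      simp [edgeWeight, h, h2] at h1
    have h3 := val_add_one_of_ne h
    have h4 : i + 1 ≠ Fin.last _ := by
      intro e
      rw [e, h2] at h3
      simp at h3
    by_cases h5 : i + 1 = 0 <;> by_cases hr : r = 0 <;>
      simp [edgeWeight, nextPos, h4, h5, hr]

lemma eq_of_isLastPos {a b : Bool × Fin (2 * r + 1)} (ha : isLastPos a) (hb : isLastPos b)
    (h : letterSign b = !letterSign (nextPos a)) : b = (!(nextPos a).1, (nextPos a).2) := by
  rw [letterSign_nextPos, if_pos ha] at h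
  obtain ⟨s, i⟩ := a
  obtain ⟨s', j⟩ := b
  cases s <;> cases s' <;> simp [isLastPos] at ha hb <;> subst ha hb <;>
    simp [letterSign, nextPos] at h ⊢
  exact eq_neg_of_add_eq_zero_left (add_one_eq_zero.2 rfl)

end

variable {G : Type*} [Group G] {n : ℕ}

/-- The relator given by the `k`-th power of an alternating word. -/
noncomputable def altRelator (r k : ℕ) (hk : 0 < k) (g : ℕ → Base G n)
    (hg : ∀ i < 2 * r, g i ∉ (pres G n).A (!i.bodd)) (hr : r = 0 → n = 0) :
    Relator (Base G n) (FP G) where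
  toHNNPres := pres G n
  Λ := Bool × Fin (2 * r + 1)
  nxt := nextPos
  inv a := (!a.1, a.2)
  δ := letterSign
  sgn := Prod.fst
  isC := isLastPos
  ew := edgeWeight
  g a := bif a.1 then g a.2 else (g (a.2 - 1 : Fin _))⁻¹
  K := k * (2 * r + 1)
  K_pos := by positivity
  k := k
  nxt_K a := nextPos_iterate_mul a k
  k_le a := le_sum_isLastPos a k
  inv_inv a := by simp
  δ_inv a := by simp [letterSign]
  ew_inv a := by obtain ⟨s, i⟩ := a; cases s <;> simp [edgeWeight]
  sgn_inv a := rfl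
  sgn_nxt a := rfl
  nxt_inv_nxt a := by obtain ⟨s, i⟩ := a; cases s <;> simp [nextPos]
  isC_inv_nxt a := by
    obtain ⟨s, i⟩ := a
    cases s
    · simp [nextPos, isLastPos, ← add_one_eq_zero]
    · simp [nextPos, isLastPos, add_one_eq_zero]
  g_inv_nxt a := by obtain ⟨s, i⟩ := a; cases s <;> simp [nextPos]
  δ_nxt := letterSign_nextPos
  g_notMem a ha := by
    obtain ⟨s, i⟩ := a
    cases s
    · have h : i ≠ 0 := by simpa [isLastPos] using ha
      have h1 := val_sub_one_of_ne h
      have h2 := hg (i - 1 : Fin _).val (by omega)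
      simpa [letterSign, ← h1] using h2
    · have h : i ≠ Fin.last _ := by simpa [isLastPos] using ha
      have h1 := val_add_one_of_ne h
      have h2 := hg i.val (Fin.val_lt_last h)
      simpa [letterSign] using h2
  ew_nxt_of_isC a ha := by
    by_cases h : r = 0
    · right
      obtain rfl := hr h
      rintro (_ | _)
      · exact MonoidHom.range_eq_bot_iff.2 (Monoid.CoprodI.ext_hom _ _ fun i => i.elim0)
      · exact MonoidHom.range_eq_bot_iff.2 (Monoid.CoprodI.ext_hom _ _ fun i => i.elim0)
    · exact .inl (edgeWeight_nextPos_of_isLastPos h ha)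
  ew_nxt_of_not_isC _ ha := edgeWeight_nextPos_of_not_isLastPos ha
  ew_consecutive _ ha h := edgeWeight_consecutive ha h
  eq_inv_nxt _ _ ha hb h := eq_of_isLastPos ha hb h

end RelIso

/-! ### The isoperimetric inequality -/

namespace RelIso

open HNNData RelIso.Relator
open scoped Pointwise Fin.NatCast Fin.CommRing

lemma Relator.evI_face_add {H F : Type*} [Group H] [Group F] (R : Relator H F) (a : R.Λ)
    (m n : ℕ) : R.evI (R.face a (m + n)) = R.evI (R.face a m) * R.evI (R.face (R.nxt^[m] a) n) := by
  induction m generalizing a with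
  | zero => simp [face]
  | succ m ih =>
    rw [Nat.add_right_comm]
    simp [face, ih, mul_assoc]

lemma Relator.evI_face_succ {H F : Type*} [Group H] [Group F] (R : Relator H F) (a : R.Λ)
    (m : ℕ) : R.evI (R.face a (m + 1)) = R.evI (R.face a m) *
      (R.T (R.δ (R.nxt^[m] a)) * R.ι (R.g (R.nxt^[m] a))) := by
  rw [face_succ', evI_append, evI_cons, evI_nil, mul_one, tok, tv_some]
  rfl

lemma Relator.evI_face_mul {H F : Type*} [Group H] [Group F] (R : Relator H F) {a : R.Λ}
    {m : ℕ} (h : ∀ j, R.nxt^[j * m] a = a) (j : ℕ) :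
    R.evI (R.face a (j * m)) = R.evI (R.face a m) ^ j := by
  induction j with
  | zero => simp [face]
  | succ j ih => rw [Nat.succ_mul, evI_face_add, ih, h, pow_succ]

/-- Conjugates of the `k`-th power of `w` and its inverse. -/
def PowConj {F : Type*} [Group F] (w : F) (k : ℕ) (f : F) : Prop :=
  ∃ (x : F) (ε : ℤ), (ε = 1 ∨ ε = -1) ∧ f = x * w ^ (ε * (k : ℤ)) * x⁻¹

section

variable {F : Type*} [Group F] {w f : F} {k : ℕ}

lemma PowConj.conj (h : PowConj w k f) (y : F) : PowConj w k (y * f * y⁻¹) := by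
  obtain ⟨x, ε, hε, rfl⟩ := h
  exact ⟨y * x, ε, hε, by group⟩

lemma PowConj.inv (h : PowConj w k f) : PowConj w k f⁻¹ := by
  obtain ⟨x, ε, hε, rfl⟩ := h
  refine ⟨x, -ε, by omega, ?_⟩
  rw [neg_mul, zpow_neg]
  group

lemma PowConj.ρ_nxt_iterate {H : Type*} [Group H] {R : Relator H F} {a : R.Λ}
    (h : PowConj w k (R.ρ a)) (m : ℕ) : PowConj w k (R.ρ (R.nxt^[m] a)) := by
  induction m with
  | zero => exact h
  | succ m ih =>
    rw [Function.iterate_succ_apply', ρ_nxt]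
    simpa only [_root_.inv_inv] using
      ih.conj (R.T (R.δ (R.nxt^[m] a)) * R.ι (R.g (R.nxt^[m] a)))⁻¹

lemma PowConj.ρ_inv {H : Type*} [Group H] {R : Relator H F} {a : R.Λ}
    (h : PowConj w k (R.ρ a)) : PowConj w k (R.ρ (R.inv a)) := by
  have h1 := h.inv.conj (R.T (R.δ a))⁻¹
  rw [← T_mul_ρ_inv] at h1
  convert h1 using 1
  group

end

variable {G : Type*} [Group G] {n : ℕ} {r k : ℕ} {hk : 0 < k} {g : ℕ → Base G n}
  {hg : ∀ i < 2 * r, g i ∉ (pres G n).A (!i.bodd)} {hr : r = 0 → n = 0}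

lemma nxt_iterate_altRelator (m : ℕ) : (altRelator r k hk g hg hr).nxt^[m] (true, 0) =
    (true, (m : Fin (2 * r + 1))) := by
  have := nextPos_iterate_true (0 : Fin (2 * r + 1)) m
  rwa [zero_add] at this

lemma evI_face_altRelator {m : ℕ} (hm : m ≤ 2 * r + 1) :
    (altRelator r k hk g hg hr).evI ((altRelator r k hk g hg hr).face (true, 0) m) = alt g m := by
  induction m with
  | zero => rfl
  | succ m ih =>
    refine (evI_face_succ _ _ m).trans (congrArg₂ _ (ih (by omega)) ?_)
    have h : ((m : Fin (2 * r + 1)) : ℕ) = m := Fin.val_cast_of_lt hm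
    refine (congrArg (fun a => (altRelator r k hk g hg hr).T ((altRelator r k hk g hg hr).δ a) *
      (altRelator r k hk g hg hr).ι ((altRelator r k hk g hg hr).g a))
      (nxt_iterate_altRelator m)).trans ?_
    change (pres G n).T (letterSign (true, (m : Fin (2 * r + 1)))) *
      (pres G n).ι (g ((m : Fin (2 * r + 1)) : ℕ)) = _
    rw [letterSign, h, pres_ι, Bool.true_xor]

lemma ρ_altRelator : (altRelator r k hk g hg hr).ρ (true, 0) = alt g (2 * r + 1) ^ k :=
  (evI_face_mul _ (nextPos_iterate_mul _) k).trans
    (congrArg (· ^ k) (evI_face_altRelator le_rfl))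

lemma powConj_ρ {w u : FP G} (hw : u * w * u⁻¹ = alt g (2 * r + 1))
    (a : (altRelator r k hk g hg hr).Λ) : PowConj w k ((altRelator r k hk g hg hr).ρ a) := by
  have h0 : PowConj w k ((altRelator r k hk g hg hr).ρ (true, 0)) := by
    refine ⟨u, 1, .inl rfl, ?_⟩
    rw [ρ_altRelator, ← hw, conj_pow, one_mul, zpow_natCast]
  have h1 : ∀ i : Fin (2 * r + 1), PowConj w k ((altRelator r k hk g hg hr).ρ (true, i)) := by
    intro i
    have h : (altRelator r k hk g hg hr).nxt^[i.val] (true, 0) = (true, i) :=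
      (nxt_iterate_altRelator i.val).trans (congrArg (Prod.mk true) (Fin.cast_val_eq_self i))
    exact h ▸ h0.ρ_nxt_iterate i.val
  obtain ⟨_ | _, i⟩ := a
  · exact (h1 i).ρ_inv
  · exact h1 i

lemma exists_list_of_mem_N {w u : FP G} (hw : u * w * u⁻¹ = alt g (2 * r + 1)) {m : ℕ} :
    ∀ {f : FP G}, f ∈ (altRelator r k hk g hg hr).N m → ∃ l : List (FP G × ℤ), l.length ≤ m ∧
      (∀ p ∈ l, p.2 = 1 ∨ p.2 = -1) ∧
      f = (l.map fun p => p.1 * w ^ (p.2 * (k : ℤ)) * p.1⁻¹).prod := by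
  induction m with
  | zero =>
    intro f hf
    exact ⟨[], by simp, by simp, by simpa using mem_N_zero.1 hf⟩
  | succ m ih =>
    intro f hf
    rw [N, pow_succ'] at hf
    obtain ⟨a, ha, b, hb, rfl⟩ := hf
    obtain ⟨l, hl, hl1, rfl⟩ := ih hb
    rcases ha with rfl | ⟨x, c, rfl⟩
    · exact ⟨l, by omega, hl1, by simp⟩
    · obtain ⟨y, ε, hε, h⟩ := (powConj_ρ hw c).conj x
      refine ⟨(y, ε) :: l, by simpa using hl, ?_, by simp [h]⟩
      intro p hp
      rcases List.mem_cons.1 hp with rfl | hp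
      · exact hε
      · exact hl1 p hp

lemma exists_mem_N_of_mem_normalClosure {w u : FP G} (hw : u * w * u⁻¹ = alt g (2 * r + 1))
    {f : FP G} (hf : f ∈ Subgroup.normalClosure {w ^ k}) :
    ∃ m, f ∈ (altRelator r k hk g hg hr).N m := by
  induction hf using Subgroup.closure_induction with
  | mem x hx =>
    obtain ⟨a, ha, hax⟩ := Group.mem_conjugatesOfSet_iff.1 hx
    rw [Set.mem_singleton_iff] at ha
    subst ha
    obtain ⟨c, rfl⟩ := isConj_iff.1 hax
    refine ⟨1, N_conj ?_ c⟩
    have h := N_conj' (ρ_mem_N (R := altRelator r k hk g hg hr) (true, 0)) u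
    rw [ρ_altRelator, ← hw, conj_pow] at h
    convert h using 1
    group
  | one => exact ⟨0, one_mem_N 0⟩
  | mul x y _ _ hx hy =>
    obtain ⟨a, ha⟩ := hx
    obtain ⟨b, hb⟩ := hy
    exact ⟨a + b, N_mul ha hb⟩
  | inv x _ hx =>
    obtain ⟨a, ha⟩ := hx
    exact ⟨a, N_inv ha⟩

open scoped Classical in
lemma exists_ev_eq_prod (n : ℕ) (L : List (FP G))
    (hL : ∀ a ∈ L, (∃ g : G, a = emb G g) ∨ a = tgen G ∨ a = (tgen G)⁻¹) :
    ∃ z, (pres G n).ev z = L.prod ∧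
      letters z ≤ L.countP fun a => decide (a = tgen G ∨ a = (tgen G)⁻¹) := by
  induction L with
  | nil => exact ⟨[], rfl, le_rfl⟩
  | cons a L ih =>
    obtain ⟨z, hz, h⟩ := ih fun b hb => hL b (List.mem_cons_of_mem _ hb)
    by_cases ha : a = tgen G ∨ a = (tgen G)⁻¹
    · rw [List.countP_cons_of_pos (by simpa using ha)]
      rcases ha with rfl | rfl
      · exact ⟨(some true, 1) :: z, by simp [hz], by simpa using h⟩
      · exact ⟨(some false, 1) :: z, by simp [hz], by simpa using h⟩
    · rw [List.countP_cons_of_neg (by simpa using ha)]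
      obtain ⟨g, rfl⟩ := (hL a List.mem_cons_self).resolve_right ha
      exact ⟨(none, Monoid.CoprodI.of (M := fun _ : Fin (n + 1) => G) (i := 0) g) :: z,
        by simp [hz], by simpa using h⟩

end RelIso

open scoped Classical in
/-- Linear relative isoperimetric inequality for `k ≥ 3`
(hence `G̃` is relatively hyperbolic with respect to `G`). -/
theorem linear_isoperimetric_of_three_le {G : Type*} [Group G] (w : FP G)
    (hw : Unimodular w) (k : ℕ) (hk : 3 ≤ k) :
    ∃ C : ℕ, 0 < C ∧
      ∀ L : List (FP G),
        (∀ a ∈ L, (∃ g : G, a = emb G g) ∨ a = tgen G ∨ a = (tgen G)⁻¹) →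
        L.prod ∈ Subgroup.normalClosure {w ^ k} →
        ∃ s : ℕ,
          s ≤ C * (L.countP fun a => decide (a = tgen G ∨ a = (tgen G)⁻¹)) ∧
          ∃ (x : Fin s → FP G) (ε : Fin s → ℤ),
            (∀ i, ε i = 1 ∨ ε i = -1) ∧
            L.prod = (List.ofFn fun i => x i * w ^ (ε i * (k : ℤ)) * (x i)⁻¹).prod := by
  obtain ⟨n, r, g, u, hu, hg, hr⟩ := RelIso.exists_alt hw
  refine ⟨1, one_pos, fun L hL hmem => ?_⟩
  obtain ⟨z, hz, hcount⟩ := RelIso.exists_ev_eq_prod n L hL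
  have hex := RelIso.exists_mem_N_of_mem_normalClosure (hk := show 0 < k by omega) (hg := hg)
    (hr := hr) hu hmem
  have harea : (RelIso.altRelator r k (by omega) g hg hr).Area
      ((RelIso.altRelator r k (by omega) g hg hr).ev z) (Nat.find hex) := by
    have h : (RelIso.altRelator r k (by omega) g hg hr).ev z = L.prod := hz
    rw [h]
    exact ⟨Nat.find_spec hex, fun m hm => Nat.find_min' hex hm⟩
  have hle := harea.le_letters hk
  obtain ⟨l, hl, hl1, hprod⟩ := RelIso.exists_list_of_mem_N hu (Nat.find_spec hex)
  refine ⟨l.length, by omega, fun i => l[i].1, fun i => l[i].2,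
    fun i => hl1 _ (List.getElem_mem _), ?_⟩
  rw [hprod]
  congr 1
  refine List.ext_getElem (by simp) fun i h1 h2 => by simp
end
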